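/- arXiv:2406.04191 — 6 statements merged into one kernel-verified Lean document; each statement's English description precedes it below -/
import Mathlib

section
/- For every 0 < p̲ < p̄ < 1 there exist constants c₀, c₁, c₂, c₃ > 0 depending only on p̲ and p̄ (one may take c₀ to be the positive solution of 60c₀p̄(√((1−p̲)/p̲))³·exp(2√((1−p̲)/p̲)·c₀) + 60c₀(1−p̲)(√(p̄/(1−p̄)))³·exp(2√(p̄/(1−p̄))·c₀) = 1, c₁ = 15c₀√(p̲(1−p̄)), c₂ = 1/(15c₀), and c₃ = 1/c₀) with the following property: for every m ∈ ℕ with c₀√m ≥ 1 and every p ∈ (p̲, p̄), there exists a probability space carrying a random variable X with the Binomial(m,p) distribution and a random variable Z with the standard normal distribution such that, almost surely on the event {|X − mp| ≤ c₁ m}, both |X − mp − √(mp(1−p))·Z| ≤ c₂ Z² + c₃ and |X − mp| ≤ 1/c₀ + 2√(mp(1−p))·|Z| hold. -/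
open MeasureTheory ProbabilityTheory Filter
open scoped ENNReal NNReal BigOperators Pointwise Classical

noncomputable section

/-- Euclidean space `ℝ^d`. -/
abbrev Euc (d : ℕ) := EuclideanSpace ℝ (Fin d)

/-- The Binomial(m, p) distribution, as a measure on `ℝ`. -/
def binom (m : ℕ) (p : ℝ) : Measure ℝ :=
  ∑ k ∈ Finset.range (m + 1),
    (ENNReal.ofReal ((m.choose k : ℝ) * p ^ k * (1 - p) ^ (m - k))) • Measure.dirac (k : ℝ)

open scoped Topology

/-- The relative entropy of the Bernoulli law with parameter `x` with respect to the Bernoulli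
law with parameter `p`. -/
def relEnt (x p : ℝ) : ℝ :=
  x * (Real.log x - Real.log p) + (1 - x) * (Real.log (1 - x) - Real.log (1 - p))

theorem relEnt_self (x : ℝ) : relEnt x x = 0 := by simp [relEnt]

theorem relEnt_one_sub (x p : ℝ) : relEnt (1 - x) (1 - p) = relEnt x p := by
  simp only [relEnt, sub_sub_cancel]; ring

theorem hasDerivAt_relEnt (x : ℝ) {p : ℝ} (h0 : 0 < p) (h1 : p < 1) :
    HasDerivAt (relEnt x) ((p - x) / (p * (1 - p))) p := by
  have h1' : (1 : ℝ) - p ≠ 0 := by linarith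
  have ha := ((Real.hasDerivAt_log h0.ne').const_sub (Real.log x)).const_mul x
  have hb := ((((hasDerivAt_id p).const_sub 1).log h1').const_sub (Real.log (1 - x))).const_mul
    (1 - x)
  refine (ha.add hb).congr_deriv ?_
  simp only [id]
  field_simp
  ring

theorem antitoneOn_relEnt_sub {x : ℝ} (hx0 : 0 < x) :
    AntitoneOn (fun p ↦ relEnt x p - (p - x) ^ 2 / (2 * x * (1 - p))) (Set.Ioo 0 1) := by
  have hd : ∀ p ∈ Set.Ioo (0 : ℝ) 1, HasDerivAt
      (fun p ↦ relEnt x p - (p - x) ^ 2 / (2 * x * (1 - p)))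
      (-((p - x) ^ 2 * (2 - p) / (2 * x * p * (1 - p) ^ 2))) p := by
    intro p hp
    have h0 := hp.1
    have h1 : 0 < 1 - p := by linarith [hp.2]
    have hn := ((hasDerivAt_id p).sub_const x).pow 2
    have hm := ((hasDerivAt_id p).const_sub 1).const_mul (2 * x)
    refine ((hasDerivAt_relEnt x hp.1 hp.2).sub (hn.div hm ?_)).congr_deriv ?_
    · simp only [id]; positivity
    · simp only [id]; field_simp; simp; ring
  refine antitoneOn_of_deriv_nonpos (convex_Ioo 0 1)
    (fun p hp ↦ (hd p hp).continuousAt.continuousWithinAt) ?_ ?_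
  · intro p hp
    exact (hd p (interior_subset hp)).differentiableAt.differentiableWithinAt
  · intro p hp
    have hp := interior_subset hp
    rw [(hd p hp).deriv, neg_nonpos]
    have h0 := hp.1
    have h1 : 0 < 1 - p := by linarith [hp.2]
    have h2 : 0 < 2 - p := by linarith
    positivity

theorem monotoneOn_relEnt_sub {x : ℝ} (hx0 : 0 < x) (hx1 : x < 1) :
    MonotoneOn (fun p ↦ relEnt x p - x * (p - x) ^ 2 / (2 * (1 - x) * p ^ 2)) (Set.Ioo 0 1) := by
  have hx1' : 0 < 1 - x := by linarith
  have hd : ∀ p ∈ Set.Ioo (0 : ℝ) 1, HasDerivAt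
      (fun p ↦ relEnt x p - x * (p - x) ^ 2 / (2 * (1 - x) * p ^ 2))
      ((p - x) ^ 2 * (p * (1 - x) + x) / (p ^ 3 * (1 - p) * (1 - x))) p := by
    intro p hp
    have h0 := hp.1
    have h1 : 0 < 1 - p := by linarith [hp.2]
    have hn := (((hasDerivAt_id p).sub_const x).pow 2).const_mul x
    have hm := ((hasDerivAt_id p).pow 2).const_mul (2 * (1 - x))
    refine ((hasDerivAt_relEnt x hp.1 hp.2).sub (hn.div hm ?_)).congr_deriv ?_
    · simp only [Pi.pow_apply, id]; positivity
    · simp only [Pi.pow_apply, id]; field_simp; simp; ring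
  refine monotoneOn_of_deriv_nonneg (convex_Ioo 0 1)
    (fun p hp ↦ (hd p hp).continuousAt.continuousWithinAt) ?_ ?_
  · intro p hp
    exact (hd p (interior_subset hp)).differentiableAt.differentiableWithinAt
  · intro p hp
    have hp := interior_subset hp
    rw [(hd p hp).deriv]
    have h0 := hp.1
    have h1 : 0 < 1 - p := by linarith [hp.2]
    positivity

section Bounds

variable {x p : ℝ}

theorem le_relEnt_of_le (hp0 : 0 < p) (hpx : p ≤ x) (hx1 : x < 1) :
    (p - x) ^ 2 / (2 * x * (1 - p)) ≤ relEnt x p := by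
  have := antitoneOn_relEnt_sub (hp0.trans_le hpx) ⟨hp0, hpx.trans_lt hx1⟩
    ⟨hp0.trans_le hpx, hx1⟩ hpx
  simp only [relEnt_self] at this
  simp at this
  exact this

theorem relEnt_le_of_ge (hx0 : 0 < x) (hxp : x ≤ p) (hp1 : p < 1) :
    relEnt x p ≤ (p - x) ^ 2 / (2 * x * (1 - p)) := by
  have := antitoneOn_relEnt_sub hx0 ⟨hx0, hxp.trans_lt hp1⟩ ⟨hx0.trans_le hxp, hp1⟩ hxp
  simp only [relEnt_self] at this
  simp at this
  exact this

theorem relEnt_le_of_le (hp0 : 0 < p) (hpx : p ≤ x) (hx1 : x < 1) :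
    relEnt x p ≤ x * (p - x) ^ 2 / (2 * (1 - x) * p ^ 2) := by
  have := monotoneOn_relEnt_sub (hp0.trans_le hpx) hx1 ⟨hp0, hpx.trans_lt hx1⟩
    ⟨hp0.trans_le hpx, hx1⟩ hpx
  simp only [relEnt_self] at this
  simp at this
  exact this

theorem le_relEnt_of_ge (hx0 : 0 < x) (hxp : x ≤ p) (hp1 : p < 1) :
    x * (p - x) ^ 2 / (2 * (1 - x) * p ^ 2) ≤ relEnt x p := by
  have := monotoneOn_relEnt_sub hx0 (hxp.trans_lt hp1) ⟨hx0, hxp.trans_lt hp1⟩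
    ⟨hx0.trans_le hxp, hp1⟩ hxp
  simp only [relEnt_self] at this
  simp at this
  exact this

theorem relEnt_nonneg (hx0 : 0 < x) (hx1 : x < 1) (hp0 : 0 < p) (hp1 : p < 1) :
    0 ≤ relEnt x p := by
  have h2 : 0 < 1 - p := by linarith
  have h3 : 0 < 1 - x := by linarith
  rcases le_total p x with h | h
  · exact le_trans (by positivity) (le_relEnt_of_le hp0 h hx1)
  · exact le_trans (by positivity) (le_relEnt_of_ge hx0 h hp1)

theorem relEnt_pos (hx0 : 0 < x) (hx1 : x < 1) (hp0 : 0 < p) (hp1 : p < 1) (hne : p ≠ x) :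
    0 < relEnt x p := by
  have h1 : 0 < (p - x) ^ 2 := by have := sub_ne_zero.2 hne; positivity
  have h2 : 0 < 1 - p := by linarith
  have h3 : 0 < 1 - x := by linarith
  rcases le_total p x with h | h
  · exact lt_of_lt_of_le (by positivity) (le_relEnt_of_le hp0 h hx1)
  · exact lt_of_lt_of_le (by positivity) (le_relEnt_of_ge hx0 h hp1)

end Bounds

/-- The function `p ↦ p ^ 2 * relEnt x p / (p - x) ^ 2`, defined off `p = x`, is increasing. -/
theorem sq_mul_relEnt_div_le {x p q : ℝ} (hx0 : 0 < x) (hx1 : x < 1) (hp0 : 0 < p) (hq1 : q < 1)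
    (hpq : p ≤ q) (hpx : p ≠ x) (hqx : q ≠ x) :
    p ^ 2 * relEnt x p / (p - x) ^ 2 ≤ q ^ 2 * relEnt x q / (q - x) ^ 2 := by
  have hx1' : 0 < 1 - x := by linarith
  have hd : ∀ r : ℝ, 0 < r → r < 1 → r ≠ x → HasDerivAt
      (fun r ↦ r ^ 2 * relEnt x r / (r - x) ^ 2)
      (r * ((r - x) ^ 2 / (1 - r) - 2 * x * relEnt x r) / (r - x) ^ 3) r := by
    intro r h0 h1 hne
    have hr : r - x ≠ 0 := sub_ne_zero.2 hne
    have h1' : 1 - r ≠ 0 := by linarith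
    have hn := ((hasDerivAt_id r).pow 2).mul (hasDerivAt_relEnt x h0 h1)
    have hm := ((hasDerivAt_id r).sub_const x).pow 2
    refine (hn.div hm ?_).congr_deriv ?_
    · simp only [Pi.pow_apply, id]; positivity
    · simp only [Pi.pow_apply, Pi.mul_apply, id]; field_simp; simp; ring
  rcases lt_or_gt_of_ne hqx with hq | hq
  · have hm : MonotoneOn (fun r ↦ r ^ 2 * relEnt x r / (r - x) ^ 2) (Set.Ioo 0 x) := by
      refine monotoneOn_of_deriv_nonneg (convex_Ioo 0 x) (fun r hr ↦
        (hd r hr.1 (hr.2.trans hx1) hr.2.ne).continuousAt.continuousWithinAt) ?_ ?_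
      · intro r hr
        have hr := interior_subset hr
        exact (hd r hr.1 (hr.2.trans hx1) hr.2.ne).differentiableAt.differentiableWithinAt
      · intro r hr
        have hr := interior_subset hr
        rw [(hd r hr.1 (hr.2.trans hx1) hr.2.ne).deriv]
        have h0 := hr.1
        have h1 : 0 < 1 - r := by linarith [hr.2]
        have h2 : (r - x) ^ 3 ≤ 0 := by
          have : r - x ≤ 0 := by linarith [hr.2]
          exact Odd.pow_nonpos (by decide) this
        refine div_nonneg_of_nonpos (mul_nonpos_of_nonneg_of_nonpos h0.le ?_) h2
        have := le_relEnt_of_le hr.1 hr.2.le hx1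
        rw [div_le_iff₀ (by positivity)] at this
        rw [sub_nonpos, div_le_iff₀ h1]
        linarith
    exact hm ⟨hp0, hpq.trans_lt hq⟩ ⟨hp0.trans_le hpq, hq⟩ hpq
  rcases lt_or_gt_of_ne hpx with hp | hp
  · have h1 := relEnt_le_of_le hp0 hp.le hx1
    have h2 := le_relEnt_of_ge hx0 hq.le hq1
    have hq' : 0 < (q - x) ^ 2 := by have := sub_ne_zero.2 hqx; positivity
    have hp' : 0 < (p - x) ^ 2 := by have := sub_ne_zero.2 hpx; positivity
    have hq0 : 0 < q := hx0.trans hq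
    have hl : p ^ 2 * relEnt x p / (p - x) ^ 2 ≤ x / (2 * (1 - x)) := by
      rw [div_le_div_iff₀ hp' (by positivity)]
      rw [le_div_iff₀ (by positivity)] at h1
      linarith
    refine hl.trans ?_
    rw [div_le_div_iff₀ (by positivity) hq']
    rw [div_le_iff₀ (by positivity)] at h2
    linarith
  · have hm : MonotoneOn (fun r ↦ r ^ 2 * relEnt x r / (r - x) ^ 2) (Set.Ioo x 1) := by
      refine monotoneOn_of_deriv_nonneg (convex_Ioo x 1) (fun r hr ↦
        (hd r (hx0.trans hr.1) hr.2 hr.1.ne').continuousAt.continuousWithinAt) ?_ ?_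
      · intro r hr
        have hr := interior_subset hr
        exact (hd r (hx0.trans hr.1) hr.2 hr.1.ne').differentiableAt.differentiableWithinAt
      · intro r hr
        have hr := interior_subset hr
        have h0 : 0 < r := hx0.trans hr.1
        rw [(hd r h0 hr.2 hr.1.ne').deriv]
        have h1 : 0 < 1 - r := by linarith [hr.2]
        have h2 : 0 < r - x := by linarith [hr.1]
        refine div_nonneg (mul_nonneg h0.le ?_) (by positivity)
        have := relEnt_le_of_ge hx0 hr.1.le hr.2
        rw [le_div_iff₀ (by positivity)] at this
        rw [sub_nonneg, le_div_iff₀ h1]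
        linarith
    exact hm ⟨hp, hpq.trans_lt hq1⟩ ⟨hq, hq1⟩ hpq

theorem hasDerivAt_cdf_gaussianReal (y : ℝ) :
    HasDerivAt (cdf (gaussianReal 0 1)) (gaussianPDFReal 0 1 y) y := by
  have hcont : Continuous (gaussianPDFReal 0 1) := by
    unfold gaussianPDFReal; fun_prop
  have hintOn : ∀ s : Set ℝ, IntegrableOn (gaussianPDFReal 0 1) s :=
    fun s ↦ (integrable_gaussianPDFReal 0 1).integrableOn
  have hcdf : ∀ z, cdf (gaussianReal 0 1) z = ∫ t in Set.Iic z, gaussianPDFReal 0 1 t := by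
    intro z
    rw [cdf_eq_real, measureReal_def, gaussianReal_apply_eq_integral 0 one_ne_zero,
      ENNReal.toReal_ofReal (integral_nonneg fun _ ↦ gaussianPDFReal_nonneg _ _ _)]
  have heq : ∀ z, cdf (gaussianReal 0 1) z =
      cdf (gaussianReal 0 1) 0 + ∫ t in (0 : ℝ)..z, gaussianPDFReal 0 1 t := by
    intro z
    rw [hcdf, hcdf, ← intervalIntegral.integral_Iic_sub_Iic (hintOn _) (hintOn _)]
    ring
  have h := (intervalIntegral.integral_hasDerivAt_right
    (hcont.intervalIntegrable 0 y) (hcont.stronglyMeasurableAtFilter _ _) hcont.continuousAt).const_add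
    (cdf (gaussianReal 0 1) 0)
  exact h.congr_of_eventuallyEq (Eventually.of_forall heq)

theorem strictMono_cdf_gaussianReal : StrictMono (cdf (gaussianReal 0 1)) :=
  strictMono_of_hasDerivAt_pos hasDerivAt_cdf_gaussianReal
    fun y ↦ gaussianPDFReal_pos 0 1 y one_ne_zero

theorem continuous_cdf_gaussianReal : Continuous (cdf (gaussianReal 0 1)) :=
  continuous_iff_continuousAt.2 fun y ↦ (hasDerivAt_cdf_gaussianReal y).continuousAt

theorem cdf_gaussianReal_neg (y : ℝ) :
    cdf (gaussianReal 0 1) (-y) = 1 - cdf (gaussianReal 0 1) y := by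
  have hneg : (gaussianReal 0 1).map (fun x ↦ -x) = gaussianReal 0 1 := by
    rw [gaussianReal_map_neg, neg_zero]
  have hna : NullSingletonClass (gaussianReal 0 1) := nullSingletonClass_gaussianReal one_ne_zero
  rw [cdf_eq_real, cdf_eq_real, ← probReal_compl_eq_one_sub measurableSet_Iic]
  conv_lhs => rw [← hneg]
  rw [map_measureReal_apply measurable_neg measurableSet_Iic]
  have : (fun x : ℝ ↦ -x) ⁻¹' Set.Iic (-y) = Set.Ici y := by ext; simp
  rw [this, Set.compl_Iic, measureReal_def, measureReal_def, Ioi_ae_eq_Ici.measure_eq]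

/-- The probability that a Binomial(m, p) variable is at most `k`. -/
def binomCdf (m k : ℕ) (p : ℝ) : ℝ :=
  ∑ i ∈ Finset.range (k + 1), (bernsteinPolynomial ℝ m i).eval p

theorem eval_bernsteinPolynomial (m i : ℕ) (p : ℝ) :
    (bernsteinPolynomial ℝ m i).eval p = (m.choose i : ℝ) * p ^ i * (1 - p) ^ (m - i) := by
  simp [bernsteinPolynomial]

theorem binomCdf_nonneg (m k : ℕ) {p : ℝ} (h0 : 0 ≤ p) (h1 : p ≤ 1) : 0 ≤ binomCdf m k p := by
  refine Finset.sum_nonneg fun i _ ↦ ?_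
  have : 0 ≤ 1 - p := by linarith
  rw [eval_bernsteinPolynomial]; positivity

theorem hasDerivAt_binomCdf (m k : ℕ) (p : ℝ) :
    HasDerivAt (binomCdf m k) (-(m * (bernsteinPolynomial ℝ (m - 1) k).eval p)) p := by
  induction k with
  | zero =>
    have h := (bernsteinPolynomial ℝ m 0).hasDerivAt p
    rw [bernsteinPolynomial.derivative_zero] at h
    have heq : binomCdf m 0 = fun p ↦ (bernsteinPolynomial ℝ m 0).eval p := by
      ext q; simp [binomCdf]
    rw [heq]
    simpa using h
  | succ k ih =>
    have h := ih.add ((bernsteinPolynomial ℝ m (k + 1)).hasDerivAt p)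
    rw [bernsteinPolynomial.derivative_succ] at h
    have heq : binomCdf m (k + 1) =
        binomCdf m k + fun p ↦ (bernsteinPolynomial ℝ m (k + 1)).eval p := by
      ext q; simp [binomCdf, Finset.sum_range_succ _ (k + 1)]
    rw [heq]
    refine h.congr_deriv ?_
    simp
    ring

theorem binomCdf_zero (m k : ℕ) : binomCdf m k 0 = 1 := by
  simp [binomCdf, bernsteinPolynomial.eval_at_0]

theorem sum_eval_bernsteinPolynomial (m : ℕ) (p : ℝ) :
    ∑ i ∈ Finset.range (m + 1), (bernsteinPolynomial ℝ m i).eval p = 1 := by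
  have := congrArg (Polynomial.eval p) (bernsteinPolynomial.sum ℝ m)
  simpa [Polynomial.eval_finsetSum] using this

theorem binomCdf_add_binomCdf_one_sub {m j k : ℕ} (h : j + k + 1 = m) (p : ℝ) :
    binomCdf m j p + binomCdf m k (1 - p) = 1 := by
  refine Eq.trans ?_ (sum_eval_bernsteinPolynomial m p)
  rw [binomCdf, binomCdf,
    show m + 1 = (j + 1) + (k + 1) by omega, Finset.sum_range_add _ (j + 1) (k + 1),
    ← Finset.sum_range_reflect _ (k + 1)]
  congr 1
  refine Finset.sum_congr rfl fun i hi ↦ ?_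
  rw [Finset.mem_range] at hi
  rw [eval_bernsteinPolynomial, eval_bernsteinPolynomial, sub_sub_cancel 1 p,
    show k + 1 - 1 - i = m - (j + 1 + i) by omega, Nat.choose_symm (by omega),
    show m - (m - (j + 1 + i)) = j + 1 + i by omega]
  ring

/-- The signed square root of twice `m` times the relative entropy. -/
def signedRootDev (m : ℕ) (x p : ℝ) : ℝ :=
  if p ≤ x then √(2 * m * relEnt x p) else -√(2 * m * relEnt x p)

theorem abs_signedRootDev (m : ℕ) (x p : ℝ) :
    |signedRootDev m x p| = √(2 * m * relEnt x p) := by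
  unfold signedRootDev
  split_ifs
  · exact abs_of_nonneg (Real.sqrt_nonneg _)
  · rw [abs_neg]; exact abs_of_nonneg (Real.sqrt_nonneg _)

theorem signedRootDev_one_sub (m : ℕ) (x p : ℝ) :
    signedRootDev m (1 - x) (1 - p) = -signedRootDev m x p := by
  unfold signedRootDev
  rw [relEnt_one_sub]
  rcases lt_trichotomy p x with h | rfl | h
  · rw [if_neg (by linarith), if_pos h.le]
  · simp [relEnt_self]
  · rw [if_pos (by linarith), if_neg (by linarith), neg_neg]

theorem signedRootDev_sq {m : ℕ} {x p : ℝ} (hx0 : 0 < x) (hx1 : x < 1) (hp0 : 0 < p)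
    (hp1 : p < 1) : signedRootDev m x p ^ 2 = 2 * m * relEnt x p := by
  have := relEnt_nonneg hx0 hx1 hp0 hp1
  rw [← sq_abs, abs_signedRootDev, Real.sq_sqrt (by positivity)]

theorem hasDerivAt_signedRootDev {m : ℕ} (hm : 0 < m) {x p : ℝ} (hx0 : 0 < x) (hx1 : x < 1)
    (hp0 : 0 < p) (hp1 : p < 1) (hne : p ≠ x) :
    HasDerivAt (signedRootDev m x)
      (-(m * |p - x| / (p * (1 - p) * √(2 * m * relEnt x p)))) p := by
  have hH := relEnt_pos hx0 hx1 hp0 hp1 hne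
  have hm' : (0 : ℝ) < m := by exact_mod_cast hm
  have hpos : 0 < 2 * m * relEnt x p := by positivity
  have h1 : 0 < 1 - p := by linarith
  have hs := ((hasDerivAt_relEnt x hp0 hp1).const_mul (2 * (m : ℝ))).sqrt hpos.ne'
  have hsp := Real.sqrt_pos.2 hpos
  rcases lt_or_gt_of_ne hne with h | h
  · have : signedRootDev m x =ᶠ[𝓝 p] fun p ↦ √(2 * m * relEnt x p) := by
      filter_upwards [eventually_lt_nhds h] with q hq
      rw [signedRootDev, if_pos hq.le]
    refine (hs.congr_of_eventuallyEq this).congr_deriv ?_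
    rw [abs_of_neg (by linarith)]
    field_simp
  · have : signedRootDev m x =ᶠ[𝓝 p] fun p ↦ -√(2 * m * relEnt x p) := by
      filter_upwards [eventually_gt_nhds h] with q hq
      rw [signedRootDev, if_neg (not_le.2 hq)]
    refine (hs.neg.congr_of_eventuallyEq this).congr_deriv ?_
    rw [abs_of_pos (by linarith)]
    field_simp

theorem continuousAt_signedRootDev {m : ℕ} (hm : 0 < m) {x p : ℝ} (hx0 : 0 < x) (hx1 : x < 1)
    (hp0 : 0 < p) (hp1 : p < 1) : ContinuousAt (signedRootDev m x) p := by
  rcases eq_or_ne p x with rfl | hne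
  · have h0 : signedRootDev m p p = 0 := by simp [signedRootDev, relEnt_self]
    have hc : ContinuousAt (fun q ↦ √(2 * m * relEnt p q)) p :=
      ((hasDerivAt_relEnt p hp0 hp1).continuousAt.const_mul _).sqrt
    rw [ContinuousAt, h0]
    refine squeeze_zero_norm (fun q ↦ (abs_signedRootDev m p q).le) ?_
    have := hc.tendsto
    simpa [relEnt_self] using this
  · exact (hasDerivAt_signedRootDev hm hx0 hx1 hp0 hp1 hne).continuousAt

theorem tendsto_signedRootDev {m : ℕ} (hm : 0 < m) {x : ℝ} (hx1 : x < 1) :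
    Tendsto (signedRootDev m x) (𝓝[<] 1) atBot := by
  have hm' : (0 : ℝ) < m := by exact_mod_cast hm
  have h1 : Tendsto (fun p : ℝ ↦ 1 - p) (𝓝[<] 1) (𝓝[>] 0) := by
    refine tendsto_nhdsWithin_of_tendsto_nhds_of_eventually_within _ ?_ ?_
    · have : Continuous fun p : ℝ ↦ 1 - p := by fun_prop
      simpa using (this.tendsto 1).mono_left nhdsWithin_le_nhds
    · filter_upwards [self_mem_nhdsWithin] with p hp
      exact sub_pos.2 (Set.mem_Iio.1 hp)
  have h2 : Tendsto (fun p : ℝ ↦ (1 - x) * (Real.log (1 - x) - Real.log (1 - p))) (𝓝[<] 1)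
      atTop := by
    refine Tendsto.const_mul_atTop (sub_pos.2 hx1) ?_
    simp only [sub_eq_add_neg (Real.log _)]
    exact tendsto_atTop_add_const_left _ _
      (tendsto_neg_atBot_atTop.comp (Real.tendsto_log_nhdsGT_zero.comp h1))
  have h3 : Tendsto (fun p ↦ x * (Real.log x - Real.log p)) (𝓝[<] 1)
      (𝓝 (x * (Real.log x - Real.log 1))) :=
    (((Real.continuousAt_log one_ne_zero).tendsto.mono_left nhdsWithin_le_nhds).const_sub
      _).const_mul _
  have h4 : Tendsto (relEnt x) (𝓝[<] 1) atTop := h3.add_atTop h2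
  have h5 : Tendsto (fun p ↦ -√(2 * m * relEnt x p)) (𝓝[<] 1) atBot :=
    tendsto_neg_atTop_atBot.comp (Real.tendsto_sqrt_atTop.comp
      (h4.const_mul_atTop (by positivity)))
  refine h5.congr' ?_
  filter_upwards [mem_nhdsWithin_of_mem_nhds (eventually_gt_nhds hx1)] with p hp
  rw [signedRootDev, if_neg (not_le.2 hp)]

theorem hasDerivAt_binomCdf_sub {m k : ℕ} (hk : 0 < k) (hkm : k < m) {p : ℝ} (hp0 : 0 < p)
    (hp1 : p < 1) (hne : p ≠ k / m) :
    HasDerivAt (fun p ↦ binomCdf m k p - cdf (gaussianReal 0 1) (signedRootDev m (k / m) p))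
      (p ^ k * (1 - p) ^ (m - 1 - k) *
        (m * (√(2 * Real.pi))⁻¹ * Real.exp (-(k * Real.log (k / m) +
            (m - k) * Real.log (1 - k / m))) /
            √(2 * m * (p ^ 2 * relEnt (k / m) p / (p - k / m) ^ 2)) -
          m * (m - 1).choose k)) p := by
  have hm : 0 < m := by omega
  have hm' : (0 : ℝ) < m := by exact_mod_cast hm
  have hk' : (0 : ℝ) < k := by exact_mod_cast hk
  have hkm' : (k : ℝ) < m := by exact_mod_cast hkm
  set x : ℝ := k / m with hx
  have hx0 : 0 < x := by positivity
  have hx1 : x < 1 := by rwa [hx, div_lt_one hm']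
  have hH := relEnt_pos hx0 hx1 hp0 hp1 hne
  have h1 : 0 < 1 - p := by linarith
  have hs : 0 < √(2 * m * relEnt x p) := Real.sqrt_pos.2 (by positivity)
  have hpx : 0 < |p - x| := abs_pos.2 (sub_ne_zero.2 hne)
  have hroot : √(2 * m * (p ^ 2 * relEnt x p / (p - x) ^ 2)) =
      p * √(2 * m * relEnt x p) / |p - x| := by
    rw [show 2 * m * (p ^ 2 * relEnt x p / (p - x) ^ 2) =
      p ^ 2 * (2 * m * relEnt x p) / (p - x) ^ 2 by ring, Real.sqrt_div (by positivity),
      Real.sqrt_mul (by positivity), Real.sqrt_sq hp0.le, Real.sqrt_sq_eq_abs]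
  have hexp : Real.exp (-(signedRootDev m x p ^ 2) / 2) =
      p ^ k * (1 - p) ^ (m - 1 - k) * (1 - p) *
        Real.exp (-(k * Real.log x + (m - k) * Real.log (1 - x))) := by
    have h2 : p ^ k * (1 - p) ^ (m - 1 - k) * (1 - p) =
        Real.exp (k * Real.log p + (m - k) * Real.log (1 - p)) := by
      rw [mul_assoc, ← pow_succ, show m - 1 - k + 1 = m - k by omega, Real.exp_add,
        ← Nat.cast_sub hkm.le, Real.exp_nat_mul, Real.exp_nat_mul, Real.exp_log hp0,
        Real.exp_log h1]
    rw [h2, ← Real.exp_add, signedRootDev_sq hx0 hx1 hp0 hp1, relEnt]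
    congr 1
    have : (k : ℝ) = m * x := by rw [hx]; field_simp
    rw [this]
    ring
  have hd := (hasDerivAt_binomCdf m k p).sub ((hasDerivAt_cdf_gaussianReal _).comp p
    (hasDerivAt_signedRootDev hm hx0 hx1 hp0 hp1 hne))
  refine hd.congr_deriv ?_
  rw [eval_bernsteinPolynomial, gaussianPDFReal, hroot]
  simp only [NNReal.coe_one, mul_one, sub_zero]
  rw [hexp]
  field_simp
  ring

theorem le_of_hasDerivAt_nonneg_off_point {f f' : ℝ → ℝ} {a b : ℝ} (x : ℝ) (hab : a ≤ b)
    (hc : ContinuousOn f (Set.Icc a b))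
    (hd : ∀ y ∈ Set.Ioo a b, y ≠ x → HasDerivAt f (f' y) y ∧ 0 ≤ f' y) : f a ≤ f b := by
  have key : ∀ c d : ℝ, a ≤ c → c ≤ d → d ≤ b → x ∉ Set.Ioo c d → f c ≤ f d := by
    intro c d hac hcd hdb hx
    have hd' : ∀ y ∈ Set.Ioo c d, HasDerivAt f (f' y) y ∧ 0 ≤ f' y := fun y hy ↦
      hd y ⟨hac.trans_lt hy.1, hy.2.trans_le hdb⟩ fun h ↦ hx (h ▸ hy)
    refine monotoneOn_of_deriv_nonneg (convex_Icc c d) (hc.mono (Set.Icc_subset_Icc hac hdb))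
      ?_ ?_ (Set.left_mem_Icc.2 hcd) (Set.right_mem_Icc.2 hcd) hcd
    · rw [interior_Icc]
      exact fun y hy ↦ (hd' y hy).1.differentiableAt.differentiableWithinAt
    · rw [interior_Icc]
      intro y hy
      rw [(hd' y hy).1.deriv]
      exact (hd' y hy).2
  by_cases hx : x ∈ Set.Ioo a b
  · exact (key a x le_rfl hx.1.le hx.2.le (by simp)).trans
      (key x b hx.1.le hx.2.le le_rfl (by simp))
  · exact key a b le_rfl hab le_rfl hx

/-- The lower half of the Zubkov-Serov inequality. -/
theorem cdf_signedRootDev_le_binomCdf {m k : ℕ} (hk : 0 < k) (hkm : k < m) {p : ℝ} (hp0 : 0 < p)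
    (hp1 : p < 1) :
    cdf (gaussianReal 0 1) (signedRootDev m (k / m) p) ≤ binomCdf m k p := by
  have hm : 0 < m := by omega
  have hm' : (0 : ℝ) < m := by exact_mod_cast hm
  have hk' : (0 : ℝ) < k := by exact_mod_cast hk
  have hkm' : (k : ℝ) < m := by exact_mod_cast hkm
  have hx0 : (0 : ℝ) < k / m := by positivity
  have hx1 : (k : ℝ) / m < 1 := by rwa [div_lt_one hm']
  set D : ℝ → ℝ :=
    fun p ↦ binomCdf m k p - cdf (gaussianReal 0 1) (signedRootDev m (k / m) p) with hD
  set w : ℝ → ℝ := fun p ↦ p ^ 2 * relEnt (k / m) p / (p - k / m) ^ 2 with hw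
  set c : ℝ := m * (√(2 * Real.pi))⁻¹ * Real.exp (-(k * Real.log (k / m) +
            (m - k) * Real.log (1 - k / m))) with hcdef
  have hc0 : 0 < c := by positivity
  set g : ℝ → ℝ := fun p ↦ c / √(2 * m * w p) - m * (m - 1).choose k with hg
  have hderiv : ∀ q : ℝ, 0 < q → q < 1 → q ≠ k / m →
      HasDerivAt D (q ^ k * (1 - q) ^ (m - 1 - k) * g q) q :=
    fun q h0 h1 hne ↦ hasDerivAt_binomCdf_sub hk hkm h0 h1 hne
  have hcont : ∀ q, 0 < q → q < 1 → ContinuousAt D q := fun q h0 h1 ↦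
    (hasDerivAt_binomCdf m k q).continuousAt.sub
      (continuous_cdf_gaussianReal.continuousAt.comp
        (continuousAt_signedRootDev hm hx0 hx1 h0 h1))
  have hanti : ∀ q r : ℝ, 0 < q → q ≤ r → r < 1 → q ≠ k / m → r ≠ k / m → g r ≤ g q := by
    intro q r hq hqr hr hqx hrx
    have hwq : 0 < w q := by
      have h1 := relEnt_pos hx0 hx1 hq (hqr.trans_lt hr) hqx
      have h2 := sub_ne_zero.2 hqx
      positivity
    have h3 : w q ≤ w r := sq_mul_relEnt_div_le hx0 hx1 hq hr hqr hqx hrx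
    simp only [hg]
    have h4 : 0 < √(2 * m * w q) := Real.sqrt_pos.2 (by positivity)
    gcongr
  suffices 0 ≤ D p by simpa [hD] using this
  by_cases hneg : ∃ q : ℝ, 0 < q ∧ q < p ∧ q ≠ k / m ∧ g q < 0
  · obtain ⟨q, hq0, hqp, hqx, hgq⟩ := hneg
    have hle : ∀ r, p < r → r < 1 → -cdf (gaussianReal 0 1) (signedRootDev m (k / m) r) ≤ D p := by
      intro r hpr hr
      have h := le_of_hasDerivAt_nonneg_off_point (f := fun y ↦ -D y)
        (f' := fun q ↦ -(q ^ k * (1 - q) ^ (m - 1 - k) * g q)) (k / m) hpr.le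
        (fun y hy ↦ (hcont y (hp0.trans_le hy.1)
          (hy.2.trans_lt hr)).neg.continuousWithinAt)
        (fun y hy hyx ↦ ⟨(hderiv y (hp0.trans hy.1) (hy.2.trans hr) hyx).neg, ?_⟩)
      · have h2 := binomCdf_nonneg m k (hp0.trans hpr).le hr.le
        simp only [hD] at h ⊢
        linarith
      · have h1 := hanti q y hq0 (hqp.trans hy.1).le (hy.2.trans hr) hqx hyx
        have h2 : 0 < 1 - y := by linarith [hy.2]
        have h3 : 0 < y := hp0.trans hy.1
        rw [neg_nonneg]
        exact mul_nonpos_of_nonneg_of_nonpos (by positivity) (by linarith)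
    have hlim : Tendsto (fun r ↦ -cdf (gaussianReal 0 1) (signedRootDev m (k / m) r)) (𝓝[<] 1)
        (𝓝 0) := by
      simpa using ((tendsto_cdf_atBot (gaussianReal 0 1)).comp (tendsto_signedRootDev hm hx1)).neg
    refine le_of_tendsto hlim ?_
    filter_upwards [Ioo_mem_nhdsLT hp1] with r hr using hle r hr.1 hr.2
  · push Not at hneg
    have hle : ∀ r, 0 < r → r < p → binomCdf m k r - 1 ≤ D p := by
      intro r hr hrp
      have h := le_of_hasDerivAt_nonneg_off_point (f := D)
        (f' := fun q ↦ q ^ k * (1 - q) ^ (m - 1 - k) * g q) (k / m) hrp.le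
        (fun y hy ↦ (hcont y (hr.trans_le hy.1) (hy.2.trans_lt hp1)).continuousWithinAt)
        (fun y hy hyx ↦ ⟨hderiv y (hr.trans hy.1) (hy.2.trans hp1) hyx, ?_⟩)
      · have h2 := cdf_le_one (gaussianReal 0 1) (signedRootDev m (k / m) r)
        simp only [hD] at h ⊢
        linarith
      · have h2 : 0 < 1 - y := by linarith [hy.2]
        have h3 : 0 < y := hr.trans hy.1
        have := hneg y h3 hy.2 hyx
        positivity
    have hlim : Tendsto (fun r ↦ binomCdf m k r - 1) (𝓝[>] 0) (𝓝 0) := by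
      have := ((hasDerivAt_binomCdf m k 0).continuousAt.tendsto.mono_left
        (nhdsWithin_le_nhds (s := Set.Ioi 0))).sub_const 1
      simpa [binomCdf_zero] using this
    refine le_of_tendsto hlim ?_
    filter_upwards [Ioo_mem_nhdsGT hp0] with r hr using hle r hr.1 hr.2

/-- The upper half of the Zubkov-Serov inequality. -/
theorem binomCdf_le_cdf_signedRootDev {m k : ℕ} (hkm : k + 1 < m) {p : ℝ} (hp0 : 0 < p)
    (hp1 : p < 1) :
    binomCdf m k p ≤ cdf (gaussianReal 0 1) (signedRootDev m ((k + 1 : ℕ) / m) p) := by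
  have hm' : (m : ℝ) ≠ 0 := Nat.cast_ne_zero.2 (by omega)
  have h := cdf_signedRootDev_le_binomCdf (m := m) (k := m - (k + 1)) (by omega) (by omega)
    (p := 1 - p) (by linarith) (by linarith)
  have h2 := binomCdf_add_binomCdf_one_sub (m := m) (j := k) (k := m - (k + 1)) (by omega) p
  rw [Nat.cast_sub hkm.le, sub_div, div_self hm', signedRootDev_one_sub,
    cdf_gaussianReal_neg] at h
  linarith

/-- The quantile transform of a standard normal variable. -/
theorem exists_quantile_transform (ν : Measure ℝ) [IsProbabilityMeasure ν] :
    ∃ X : ℝ → ℝ, Measurable X ∧ (gaussianReal 0 1).map X = ν ∧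
      ∀ z y, X z ≤ y ↔ cdf (gaussianReal 0 1) z ≤ cdf ν y := by
  set Φ := cdf (gaussianReal 0 1) with hΦ
  have hpos : ∀ z, 0 < Φ z := fun z ↦
    (cdf_nonneg _ (z - 1)).trans_lt (strictMono_cdf_gaussianReal (by linarith))
  have hlt : ∀ z, Φ z < 1 := fun z ↦
    (strictMono_cdf_gaussianReal (lt_add_one z)).trans_le (cdf_le_one _ (z + 1))
  have hX : ∀ z y, sInf {y | Φ z ≤ cdf ν y} ≤ y ↔ Φ z ≤ cdf ν y := by
    intro z y
    have hne : {y | Φ z ≤ cdf ν y}.Nonempty :=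
      ((tendsto_cdf_atTop ν).eventually (eventually_ge_nhds (hlt z))).exists
    have hbdd : BddBelow {y | Φ z ≤ cdf ν y} := by
      obtain ⟨b, hb⟩ := ((tendsto_cdf_atBot ν).eventually (eventually_lt_nhds (hpos z))).exists
      refine ⟨b, fun y hy ↦ ?_⟩
      by_contra! h
      exact absurd (hb.trans_le hy) (not_lt.2 (monotone_cdf ν h.le))
    refine ⟨fun h ↦ ?_, fun h ↦ csInf_le hbdd h⟩
    have hr : Tendsto (cdf ν) (𝓝[>] y) (𝓝 (cdf ν y)) :=
      ((cdf ν).right_continuous y).tendsto.mono_left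
        (nhdsWithin_mono _ Set.Ioi_subset_Ici_self)
    refine ge_of_tendsto hr ?_
    filter_upwards [self_mem_nhdsWithin] with t ht
    obtain ⟨s, hs, hst⟩ := exists_lt_of_csInf_lt hne (h.trans_lt ht)
    exact le_trans hs (monotone_cdf ν hst.le)
  have hmeas : Measurable fun z ↦ sInf {y | Φ z ≤ cdf ν y} := by
    refine Monotone.measurable fun a b hab ↦ ?_
    rw [hX]
    exact (monotone_cdf _ hab).trans ((hX b _).1 le_rfl)
  refine ⟨fun z ↦ sInf {y | Φ z ≤ cdf ν y}, hmeas, ?_, hX⟩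
  have : IsProbabilityMeasure ((gaussianReal 0 1).map fun z ↦ sInf {y | Φ z ≤ cdf ν y}) :=
    Measure.isProbabilityMeasure_map hmeas.aemeasurable
  refine Measure.eq_of_cdf _ _ (StieltjesFunction.ext fun y ↦ ?_)
  rw [cdf_eq_real, map_measureReal_apply hmeas measurableSet_Iic]
  have hpre : (fun z ↦ sInf {y | Φ z ≤ cdf ν y}) ⁻¹' Set.Iic y = {z | Φ z ≤ cdf ν y} := by
    ext z; exact hX z y
  rw [hpre]
  rcases (cdf_nonneg ν y).eq_or_lt with h0 | h0
  · rw [← h0]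
    have : {z | Φ z ≤ 0} = ∅ := by
      ext z; simpa using hpos z
    simp [this]
  rcases (cdf_le_one ν y).eq_or_lt with h1 | h1
  · rw [h1]
    have : {z | Φ z ≤ 1} = Set.univ := by
      ext z; simpa using (hlt z).le
    simp [this]
  · obtain ⟨a, ha⟩ := ((tendsto_cdf_atBot (gaussianReal 0 1)).eventually
      (eventually_lt_nhds h0)).exists
    obtain ⟨b, hb⟩ := ((tendsto_cdf_atTop (gaussianReal 0 1)).eventually
      (eventually_gt_nhds h1)).exists
    obtain ⟨t, ht⟩ := mem_range_of_exists_le_of_exists_ge continuous_cdf_gaussianReal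
      ⟨a, ha.le⟩ ⟨b, hb.le⟩
    have : {z | Φ z ≤ cdf ν y} = Set.Iic t := by
      ext z
      rw [Set.mem_ofPred_eq, ← ht]
      exact strictMono_cdf_gaussianReal.le_iff_le
    rw [this, ← cdf_eq_real, ht]

section Binomial

variable {m : ℕ} {p : ℝ}

theorem binom_apply (h0 : 0 ≤ p) (h1 : p ≤ 1) {s : Set ℝ} (hs : MeasurableSet s) :
    binom m p s = ENNReal.ofReal (∑ i ∈ Finset.range (m + 1),
      s.indicator (fun _ ↦ (bernsteinPolynomial ℝ m i).eval p) (i : ℝ)) := by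
  have h2 : 0 ≤ 1 - p := by linarith
  have hnn : ∀ i, 0 ≤ (bernsteinPolynomial ℝ m i).eval p := fun i ↦ by
    rw [eval_bernsteinPolynomial]; positivity
  rw [ENNReal.ofReal_sum_of_nonneg fun i _ ↦ Set.indicator_nonneg (fun _ _ ↦ hnn i) _]
  simp only [binom, Measure.coe_finsetSum, Finset.sum_apply, Measure.smul_apply, smul_eq_mul,
    Measure.dirac_apply' _ hs]
  refine Finset.sum_congr rfl fun i _ ↦ ?_
  rw [← eval_bernsteinPolynomial]
  by_cases h : (i : ℝ) ∈ s <;> simp [h]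

theorem isProbabilityMeasure_binom (h0 : 0 ≤ p) (h1 : p ≤ 1) :
    IsProbabilityMeasure (binom m p) := by
  constructor
  rw [binom_apply h0 h1 MeasurableSet.univ]
  simp [sum_eval_bernsteinPolynomial]

theorem cdf_binom (h0 : 0 ≤ p) (h1 : p ≤ 1) {k : ℕ} (hk : k ≤ m) :
    cdf (binom m p) k = binomCdf m k p := by
  have := isProbabilityMeasure_binom (m := m) h0 h1
  rw [cdf_eq_real, measureReal_def, binom_apply h0 h1 measurableSet_Iic]
  have : ∑ i ∈ Finset.range (m + 1),
      (Set.Iic (k : ℝ)).indicator (fun _ ↦ (bernsteinPolynomial ℝ m i).eval p) (i : ℝ) =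
      binomCdf m k p := by
    simp only [Set.indicator_apply]
    rw [← Finset.sum_filter, binomCdf]
    congr 1
    ext i
    simp
    omega
  rw [this, ENNReal.toReal_ofReal (binomCdf_nonneg m k h0 h1)]

theorem ae_binom (m : ℕ) (p : ℝ) : ∀ᵐ y : ℝ ∂binom m p, ∃ k : ℕ, k ≤ m ∧ y = k := by
  have hs : MeasurableSet {y : ℝ | ∃ k : ℕ, k ≤ m ∧ y = k} := by
    have : {y : ℝ | ∃ k : ℕ, k ≤ m ∧ y = k} =
        (fun k : ℕ ↦ (k : ℝ)) '' Set.Iic m := by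
      ext y; simp [eq_comm]
    rw [this]
    exact ((Set.finite_Iic m).image _).measurableSet
  rw [ae_iff, binom, Measure.coe_finsetSum, Finset.sum_apply]
  refine Finset.sum_eq_zero fun i hi ↦ ?_
  rw [← Set.compl_ofPred, Measure.smul_apply, Measure.dirac_apply' _ hs.compl, smul_eq_mul,
    mul_eq_zero]
  right
  have : i ≤ m := by rw [Finset.mem_range] at hi; omega
  simpa using this

/-- Quantile coupling of a binomial and a standard normal variable. -/
theorem exists_binom_gaussian_coupling (m : ℕ) (h0 : 0 < p) (h1 : p < 1) :
    ∃ X : ℝ → ℝ, (gaussianReal 0 1).map X = binom m p ∧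
      ∀ᵐ z ∂gaussianReal 0 1, ∃ k : ℕ, X z = k ∧
        (1 < k → k ≤ m → signedRootDev m ((k - 1 : ℝ) / m) p ≤ z) ∧
        (k + 1 < m → z ≤ signedRootDev m ((k + 1 : ℝ) / m) p) := by
  have := isProbabilityMeasure_binom (m := m) h0.le h1.le
  obtain ⟨X, hmeas, hmap, hX⟩ := exists_quantile_transform (binom m p)
  refine ⟨X, hmap, ?_⟩
  have hae := ae_binom m p
  rw [← hmap] at hae
  filter_upwards [ae_of_ae_map hmeas.aemeasurable hae] with z hz
  obtain ⟨k, -, hk⟩ := hz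
  refine ⟨k, hk, fun hk1 hkm ↦ ?_, fun hkm ↦ ?_⟩
  · have h : ¬ X z ≤ ((k - 1 : ℕ) : ℝ) := by
      rw [hk, Nat.cast_le]; omega
    rw [hX, not_le, cdf_binom h0.le h1.le (by omega)] at h
    have h2 := (cdf_signedRootDev_le_binomCdf (m := m) (k := k - 1) (by omega) (by omega)
      h0 h1).trans_lt h
    rw [Nat.cast_sub hk1.le, Nat.cast_one] at h2
    exact (strictMono_cdf_gaussianReal.lt_iff_lt.1 h2).le
  · have h := (hX z k).1 hk.le
    rw [cdf_binom h0.le h1.le (by omega)] at h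
    have h2 := h.trans (binomCdf_le_cdf_signedRootDev hkm h0 h1)
    rw [Nat.cast_add, Nat.cast_one] at h2
    exact strictMono_cdf_gaussianReal.le_iff_le.1 h2

end Binomial

theorem exists_relEnt_mul_eq {x p : ℝ} (hx0 : 0 < x) (hx1 : x < 1) (hp0 : 0 < p) (hp1 : p < 1)
    (hpx : p ≤ 2 * x) :
    ∃ θ : ℝ, 2 * relEnt x p * θ = (x - p) ^ 2 ∧ |θ - p * (1 - p)| ≤ 2 * |x - p| := by
  rcases eq_or_ne p x with rfl | hne
  · exact ⟨p * (1 - p), by simp [relEnt_self]⟩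
  have hH := relEnt_pos hx0 hx1 hp0 hp1 hne
  have hp1' : 0 < 1 - p := by linarith
  have hx1' : 0 < 1 - x := by linarith
  refine ⟨(x - p) ^ 2 / (2 * relEnt x p), by field_simp, ?_⟩
  have hmid : (1 - x) * p ^ 2 / x = p * (1 - p) - p / x * (x - p) := by field_simp; ring
  have hpx' : p / x ≤ 2 := by rwa [div_le_iff₀ hx0]
  rcases lt_or_gt_of_ne hne with h | h
  · have h1 := le_relEnt_of_le hp0 h.le hx1
    have h2 := relEnt_le_of_le hp0 h.le hx1
    rw [div_le_iff₀ (by positivity)] at h1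
    rw [le_div_iff₀ (by positivity)] at h2
    have h3 : (x - p) ^ 2 / (2 * relEnt x p) ≤ x * (1 - p) := by
      rw [div_le_iff₀ (by positivity)]; linarith
    have h4 : (1 - x) * p ^ 2 / x ≤ (x - p) ^ 2 / (2 * relEnt x p) := by
      rw [div_le_div_iff₀ hx0 (by positivity)]; linarith
    rw [hmid] at h4
    rw [abs_of_pos (sub_pos.2 h), abs_le]
    constructor <;> nlinarith
  · have h1 := relEnt_le_of_ge hx0 h.le hp1
    have h2 := le_relEnt_of_ge hx0 h.le hp1
    rw [le_div_iff₀ (by positivity)] at h1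
    rw [div_le_iff₀ (by positivity)] at h2
    have h3 : x * (1 - p) ≤ (x - p) ^ 2 / (2 * relEnt x p) := by
      rw [le_div_iff₀ (by positivity)]; linarith
    have h4 : (x - p) ^ 2 / (2 * relEnt x p) ≤ (1 - x) * p ^ 2 / x := by
      rw [div_le_div_iff₀ (by positivity) hx0]; linarith
    rw [hmid] at h4
    rw [abs_of_neg (sub_neg.2 h), abs_le]
    constructor <;> nlinarith

theorem signedRootDev_estimates {a p j : ℝ} {m : ℕ} (hm : 0 < m) (ha : 0 < a) (hap : a ≤ p)
    (hpa : a ≤ 1 - p) (hj : |j - m * p| ≤ a / 16 * m) :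
    |j - m * p - √(m * p * (1 - p)) * signedRootDev m (j / m) p| ≤
        16 / (3 * a) * ((j - m * p) ^ 2 / m) ∧
      |j - m * p| ≤ 2 * √(m * p * (1 - p)) * |signedRootDev m (j / m) p| ∧
      (j - m * p) ^ 2 / m ≤ signedRootDev m (j / m) p ^ 2 ∧
      (0 ≤ j - m * p → 0 ≤ signedRootDev m (j / m) p) ∧
      (j - m * p ≤ 0 → signedRootDev m (j / m) p ≤ 0) := by
  have hm' : (0 : ℝ) < m := by exact_mod_cast hm
  have hp0 : 0 < p := by linarith
  have hq0 : 0 < 1 - p := by linarith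
  obtain ⟨x, rfl⟩ : ∃ x : ℝ, j = m * x := ⟨j / m, by field_simp⟩
  rw [mul_div_cancel_left₀ x hm'.ne']
  have hy : m * x - m * p = m * (x - p) := by ring
  rw [hy] at hj ⊢
  rw [abs_mul, abs_of_pos hm', mul_comm, mul_le_mul_iff_left₀ hm'] at hj
  have hj' := abs_le.1 hj
  have hx0 : 0 < x := by linarith
  have hx1 : x < 1 := by linarith
  obtain ⟨θ, hθ, hθ'⟩ := exists_relEnt_mul_eq hx0 hx1 hp0 (by linarith) (by linarith)
  have hpq : a / 2 ≤ p * (1 - p) := by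
    rcases le_total p (1 / 2) with h | h <;> nlinarith
  have hpq' : p * (1 - p) ≤ 1 / 4 := by nlinarith [sq_nonneg (p - 1 / 2)]
  have hθa := abs_le.1 hθ'
  have hθ1 : 3 / 4 * (p * (1 - p)) ≤ θ := by linarith
  have hθ2 : θ ≤ 5 / 4 * (p * (1 - p)) := by linarith
  have hθ0 : 0 < θ := by linarith
  have hH := relEnt_nonneg hx0 hx1 hp0 (by linarith)
  have hsq : signedRootDev m x p ^ 2 = 2 * m * relEnt x p :=
    signedRootDev_sq hx0 hx1 hp0 (by linarith)
  have hpos : 0 ≤ x - p → 0 ≤ signedRootDev m x p := by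
    intro h
    rw [signedRootDev, if_pos (by linarith)]
    exact Real.sqrt_nonneg _
  have hneg : x - p ≤ 0 → signedRootDev m x p ≤ 0 := by
    intro h
    rcases h.eq_or_lt with h | h
    · have : x = p := by linarith
      rw [this]
      simp [signedRootDev, relEnt_self]
    · rw [signedRootDev, if_neg (by linarith), neg_nonpos]
      exact Real.sqrt_nonneg _
  set C := signedRootDev m x p with hC
  set σ := √(m * p * (1 - p)) with hσ
  have hσ0 : 0 < σ := Real.sqrt_pos.2 (by positivity)
  have hσ2 : σ ^ 2 = m * p * (1 - p) := Real.sq_sqrt (by positivity)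
  have hdist : |m * (x - p) - σ * C| = |m * (|x - p|) - σ * (|C|)| := by
    rcases le_total 0 (x - p) with h | h
    · rw [abs_of_nonneg h, abs_of_nonneg (hpos h)]
    · rw [abs_of_nonpos h, abs_of_nonpos (hneg h), ← abs_neg]
      congr 1
      ring
  set u := |x - p| with hu
  have hu0 : 0 ≤ u := abs_nonneg _
  have hu2 : (x - p) ^ 2 = u ^ 2 := (sq_abs _).symm
  set v := σ * |C| with hv
  have hv0 : 0 ≤ v := by positivity
  have hvθ : v ^ 2 * θ = p * (1 - p) * (m * u) ^ 2 := by
    rw [hv, mul_pow, sq_abs, hσ2, hsq, mul_pow, ← hu2, ← hθ]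
    ring
  refine ⟨?_, ?_, ?_, fun h ↦ hpos (by nlinarith), fun h ↦ hneg (by nlinarith)⟩
  · rw [hdist]
    have h1 : |m * u - v| * (m * u + v) * θ ≤ 2 * u * (m * u) ^ 2 := by
      have : |m * u - v| * (m * u + v) * θ = |θ - p * (1 - p)| * (m * u) ^ 2 := by
        rw [← abs_of_nonneg (show 0 ≤ m * u + v by positivity), ← abs_mul,
          ← abs_of_pos hθ0, ← abs_mul, abs_of_pos hθ0,
          ← abs_of_nonneg (sq_nonneg (m * u)), ← abs_mul]
        congr 1
        linear_combination -hvθ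
      rw [this]
      gcongr
    rcases hu0.eq_or_lt with h0 | h0
    · have hv' : v = 0 := by
        rw [← h0] at hvθ
        simpa [hθ0.ne'] using hvθ
      rw [← h0, hv']
      simp
      positivity
    · have h2 : |m * u - v| * (m * u) * (3 * a / 8) ≤ 2 * u * (m * u) ^ 2 := by
        refine le_trans ?_ h1
        gcongr
        · linarith
        · linarith
      rw [mul_pow, hu2, show 16 / (3 * a) * (m ^ 2 * u ^ 2 / m) =
        (2 * u * (m * u) ^ 2) / (m * u * (3 * a / 8)) by field_simp; ring,
        le_div_iff₀ (by positivity)]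
      linarith
  · rw [abs_mul, abs_of_pos hm', ← hu, mul_assoc, ← hv]
    refine abs_le_of_sq_le_sq' ?_ (by positivity) |>.2
    have h1 : p * (1 - p) * (m * u) ^ 2 ≤ p * (1 - p) * (2 * v) ^ 2 := by
      rw [← hvθ]
      nlinarith [mul_le_mul_of_nonneg_left hθ2 (sq_nonneg v), sq_nonneg v]
    exact le_of_mul_le_mul_left h1 (by positivity)
  · rw [hsq, mul_pow, hu2, div_le_iff₀ hm', ← hu2, ← hθ]
    have : relEnt x p * θ ≤ relEnt x p := mul_le_of_le_one_right hH (by linarith)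
    linarith [mul_le_mul_of_nonneg_left this (show 0 ≤ 2 * (m : ℝ) ^ 2 by positivity)]

theorem coupling_bounds_of_estimates {A m y z σ L R : ℝ} (hA : 0 ≤ A) (hm : 1 ≤ m) (hσ : 0 ≤ σ)
    (hLz : L ≤ z) (hzR : z ≤ R)
    (l1 : |y - 1 - σ * L| ≤ A * ((y - 1) ^ 2 / m)) (l2 : |y - 1| ≤ 2 * σ * |L|)
    (l3 : (y - 1) ^ 2 / m ≤ L ^ 2) (l4 : 0 ≤ y - 1 → 0 ≤ L)
    (r1 : |y + 1 - σ * R| ≤ A * ((y + 1) ^ 2 / m)) (r2 : |y + 1| ≤ 2 * σ * |R|)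
    (r3 : (y + 1) ^ 2 / m ≤ R ^ 2) (r5 : y + 1 ≤ 0 → R ≤ 0) :
    |y - σ * z| ≤ A * (4 * z ^ 2 + 6) + 1 ∧ |y| ≤ 1 + 2 * σ * |z| := by
  have hm' : 0 < m := by linarith
  have hσL : σ * L ≤ σ * z := by gcongr
  have hσR : σ * z ≤ σ * R := by gcongr
  have hyz : y ^ 2 ≤ (2 * z ^ 2 + 2) * m ∧ |y| ≤ 1 + 2 * σ * |z| := by
    rcases le_or_gt 1 y with h | h
    · have hL := l4 (by linarith)
      rw [div_le_iff₀ hm'] at l3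
      rw [abs_of_nonneg (by linarith), abs_of_nonneg hL] at l2
      rw [abs_of_nonneg (by linarith : 0 ≤ y), abs_of_nonneg (hL.trans hLz)]
      have : L ^ 2 * m ≤ z ^ 2 * m := by gcongr
      exact ⟨by nlinarith [sq_nonneg (y - 2)], by linarith⟩
    rcases le_or_gt y (-1) with h' | h'
    · have hR := r5 (by linarith)
      rw [div_le_iff₀ hm'] at r3
      rw [abs_of_nonpos (by linarith), abs_of_nonpos hR] at r2
      rw [abs_of_nonpos (by linarith : y ≤ 0), abs_of_nonpos (hzR.trans hR)]
      have : R ^ 2 * m ≤ z ^ 2 * m := by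
        have : R ^ 2 ≤ z ^ 2 := by nlinarith
        gcongr
      exact ⟨by nlinarith [sq_nonneg (y + 2)], by linarith⟩
    · refine ⟨by nlinarith [sq_nonneg z], ?_⟩
      have : |y| ≤ 1 := abs_le.2 ⟨h'.le, h.le⟩
      have : 0 ≤ 2 * σ * |z| := by positivity
      linarith
  refine ⟨?_, hyz.2⟩
  have hAt : ∀ t : ℝ, t ^ 2 ≤ 2 * y ^ 2 + 2 → A * (t ^ 2 / m) ≤ A * (4 * z ^ 2 + 6) := by
    intro t ht
    have h1 : t ^ 2 / m ≤ 4 * z ^ 2 + 6 := by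
      rw [div_le_iff₀ hm']; linarith [hyz.1]
    gcongr
  have hL := hAt (y - 1) (by nlinarith [sq_nonneg (y + 1)])
  have hR := hAt (y + 1) (by nlinarith [sq_nonneg (y - 1)])
  have l1' := abs_le.1 (l1.trans hL)
  have r1' := abs_le.1 (r1.trans hR)
  rw [abs_le]
  constructor <;> linarith

theorem coupling_bounds {a p z : ℝ} {m k : ℕ} (ha : 0 < a) (hap : a ≤ p) (hpa : a ≤ 1 - p)
    (hm : 1 ≤ a / 32 * m) (hk : |k - m * p| ≤ a / 32 * m)
    (hl : 1 < k → k ≤ m → signedRootDev m ((k - 1 : ℝ) / m) p ≤ z)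
    (hr : k + 1 < m → z ≤ signedRootDev m ((k + 1 : ℝ) / m) p) :
    |k - m * p - √(m * p * (1 - p)) * z| ≤
        64 / (3 * a) * z ^ 2 + (32 / a + 1) ∧
      |k - m * p| ≤ 1 + 2 * √(m * p * (1 - p)) * |z| := by
  have hm0 : 0 < m := by
    rcases Nat.eq_zero_or_pos m with rfl | h
    · norm_num at hm
    · exact h
  have hm' : (0 : ℝ) < m := by exact_mod_cast hm0
  have hm1 : (1 : ℝ) ≤ m := by exact_mod_cast hm0
  have hk' := abs_le.1 hk
  have hpm : a * m ≤ p * m := by gcongr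
  have hqm : a * m ≤ (1 - p) * m := by gcongr
  have hk1 : 1 < k := by
    have : (1 : ℝ) < k := by linarith
    exact_mod_cast this
  have hkm : k + 1 < m := by
    have : (k : ℝ) + 1 < m := by linarith
    exact_mod_cast this
  have hl := hl hk1 (by omega)
  have hr := hr hkm
  obtain ⟨l1, l2, l3, l4, -⟩ := signedRootDev_estimates (j := k - 1) hm0 ha hap hpa
    (by rw [abs_le]; constructor <;> linarith)
  obtain ⟨r1, r2, r3, -, r5⟩ := signedRootDev_estimates (j := k + 1) hm0 ha hap hpa
    (by rw [abs_le]; constructor <;> linarith)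
  rw [show (k : ℝ) - 1 - m * p = k - m * p - 1 by ring] at l1 l2 l3 l4
  rw [show (k : ℝ) + 1 - m * p = k - m * p + 1 by ring] at r1 r2 r3 r5
  obtain ⟨h1, h2⟩ := coupling_bounds_of_estimates (by positivity) hm1 (Real.sqrt_nonneg _)
    hl hr l1 l2 l3 l4 r1 r2 r3 r5
  refine ⟨h1.trans_eq ?_, h2⟩
  field_simp
  ring

/-- Binomial–Gaussian coupling: for every `0 < p̲ < p̄ < 1` there are constants
`c₀, c₁, c₂, c₃ > 0` depending only on `p̲, p̄` such that for every `m` with `c₀ √m ≥ 1` and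
every `p ∈ (p̲, p̄)` there is a probability space carrying `X ~ Bin(m,p)` and `Z ~ N(0,1)` with,
almost surely on the event `{|X - mp| ≤ c₁ m}`,
`|X - mp - √(mp(1-p)) Z| ≤ c₂ Z² + c₃` and `|X - mp| ≤ 1/c₀ + 2√(mp(1-p)) |Z|`. -/
theorem statement_7 (pl pu : ℝ) (hpl : 0 < pl) (hlu : pl < pu) (hpu : pu < 1) :
    ∃ c₀ c₁ c₂ c₃ : ℝ, 0 < c₀ ∧ 0 < c₁ ∧ 0 < c₂ ∧ 0 < c₃ ∧
      ∀ (m : ℕ) (p : ℝ), 1 ≤ c₀ * Real.sqrt m → pl < p → p < pu →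
        ∃ (Ω : Type) (_ : MeasurableSpace Ω) (Pr : Measure Ω),
          IsProbabilityMeasure Pr ∧
          ∃ X Z : Ω → ℝ,
            Measure.map X Pr = binom m p ∧
            Measure.map Z Pr = gaussianReal 0 1 ∧
            ∀ᵐ ω ∂Pr, |X ω - m * p| ≤ c₁ * m →
              (|X ω - m * p - Real.sqrt (m * p * (1 - p)) * Z ω| ≤ c₂ * Z ω ^ 2 + c₃ ∧
                |X ω - m * p| ≤ 1 / c₀ + 2 * Real.sqrt (m * p * (1 - p)) * |Z ω|) := by
  have hq : 0 < 1 - pu := by linarith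
  obtain ⟨a, ha, hal, hau⟩ : ∃ a : ℝ, 0 < a ∧ a ≤ pl ∧ a ≤ 1 - pu :=
    ⟨min pl (1 - pu), lt_min hpl hq, min_le_left _ _, min_le_right _ _⟩
  refine ⟨a / 32, a / 32, 64 / (3 * a), 32 / a + 1, by positivity, by positivity, by positivity,
    by positivity, fun m p hm hlp hpu' ↦ ?_⟩
  obtain ⟨X, hX, hae⟩ := exists_binom_gaussian_coupling (p := p) m (by linarith) (by linarith)
  refine ⟨ℝ, inferInstance, gaussianReal 0 1, inferInstance, X, id, hX, Measure.map_id, ?_⟩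
  have hs : 1 ≤ √(m : ℝ) := by nlinarith [Real.sqrt_nonneg (m : ℝ)]
  have hm' : 1 ≤ a / 32 * m := by
    have : √(m : ℝ) * √(m : ℝ) = m := Real.mul_self_sqrt (Nat.cast_nonneg m)
    nlinarith
  filter_upwards [hae] with z hz hdev
  obtain ⟨k, hk, hl, hr⟩ := hz
  rw [hk] at hdev ⊢
  obtain ⟨h1, h2⟩ := coupling_bounds ha (by linarith) (by linarith) hm' hdev hl hr
  refine ⟨h1, h2.trans ?_⟩
  have : 1 ≤ 1 / (a / 32) := by
    rw [le_div_iff₀ (by positivity)]; linarith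
  simp only [id]
  linarith
end
end

section
/- Let P be a probability measure on ℝ^d, let {C_{j,k}} be a quasi-dyadic expansion of depth K with parameter ρ ≥ 1 with respect to P, and let x₁,…,x_n be i.i.d. with law P. Define the counts U_{j,k} = Σ_{i=1}^n 1(x_i ∈ C_{j,k}) and the split probabilities p_{j,k} = P(C_{j−1,2k})/P(C_{j,k}). Then for every c₁ ∈ (0,1], P( there exists (j,k) ∈ I_K with |U_{j−1,2k} − p_{j,k} U_{j,k}| > c₁ U_{j,k} ) ≤ 3 · 2^K · exp( − min{c₁²/3, 1/8} · ρ^{−1} · n · 2^{−K} ). -/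
open MeasureTheory ProbabilityTheory Filter
open scoped ENNReal NNReal BigOperators Pointwise Classical

noncomputable section

/-- A quasi-dyadic expansion of depth `K` with parameter `ρ ≥ 1` with respect to a probability
measure `P` on `ℝ^d`: Borel cells `C j k` (`0 ≤ j ≤ K`, `0 ≤ k < 2^(K-j)`) with
`P (C K 0) = 1`, each `C j k` (`1 ≤ j ≤ K`) the disjoint union of `C (j-1) (2k)` and
`C (j-1) (2k+1)`, all terminal cells of positive measure, and
`max_k P (C 0 k) ≤ ρ · min_k P (C 0 k)`. -/
structure QuasiDyadic (d : ℕ) (P : Measure (Euc d)) (K : ℕ) (ρ : ℝ) where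
  C : ℕ → ℕ → Set (Euc d)
  meas : ∀ j k, MeasurableSet (C j k)
  total : P (C K 0) = 1
  union : ∀ j k, 1 ≤ j → j ≤ K → k < 2 ^ (K - j) →
    C j k = C (j - 1) (2 * k) ∪ C (j - 1) (2 * k + 1)
  disj : ∀ j k, 1 ≤ j → j ≤ K → k < 2 ^ (K - j) →
    Disjoint (C (j - 1) (2 * k)) (C (j - 1) (2 * k + 1))
  pos : ∀ k, k < 2 ^ K → 0 < P (C 0 k)
  ratio : ∀ k, k < 2 ^ K → ∀ k', k' < 2 ^ K →
    P (C 0 k) ≤ ENNReal.ofReal ρ * P (C 0 k')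

/-- The Haar-type function `ẽ_{j,k}` attached to a cell expansion. -/
def eTil {d : ℕ} (P : Measure (Euc d)) (Cf : ℕ → ℕ → Set (Euc d)) (j k : ℕ) : Euc d → ℝ :=
  fun x =>
    (P (Cf (j - 1) (2 * k + 1))).toReal / (P (Cf j k)).toReal *
        Set.indicator (Cf (j - 1) (2 * k)) (fun _ => (1 : ℝ)) x -
      (P (Cf (j - 1) (2 * k))).toReal / (P (Cf j k)).toReal *
        Set.indicator (Cf (j - 1) (2 * k + 1)) (fun _ => (1 : ℝ)) x

/-- Every cell is at least as heavy as some terminal cell. -/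
lemma QuasiDyadic.le_measure {d K : ℕ} {P : Measure (Euc d)} {ρ : ℝ} (D : QuasiDyadic d P K ρ)
    {m : ℝ≥0∞} (hm : ∀ k, k < 2 ^ K → m ≤ P (D.C 0 k)) :
    ∀ j k, j ≤ K → k < 2 ^ (K - j) → m ≤ P (D.C j k) := by
  intro j
  induction j with
  | zero => intro k _ hk; exact hm k (by simpa using hk)
  | succ j ih =>
    intro k hj hk
    have h2 : 2 ^ (K - j) = 2 * 2 ^ (K - (j + 1)) := by
      rw [← pow_succ']; congr 1; omega
    refine (ih (2 * k) (by omega) (by omega)).trans (measure_mono ?_)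
    rw [D.union (j + 1) k (by omega) hj hk]
    exact Set.subset_union_left

/-- A cell at level `j` is a union of `2 ^ j` terminal cells. -/
lemma QuasiDyadic.measure_le {d K : ℕ} {P : Measure (Euc d)} {ρ : ℝ} (D : QuasiDyadic d P K ρ)
    {M : ℝ≥0∞} (hM : ∀ k, k < 2 ^ K → P (D.C 0 k) ≤ M) :
    ∀ j k, j ≤ K → k < 2 ^ (K - j) → P (D.C j k) ≤ 2 ^ j * M := by
  intro j
  induction j with
  | zero => intro k _ hk; simpa using hM k (by simpa using hk)
  | succ j ih =>
    intro k hj hk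
    have h2 : 2 ^ (K - j) = 2 * 2 ^ (K - (j + 1)) := by
      rw [← pow_succ']; congr 1; omega
    rw [D.union (j + 1) k (by omega) hj hk]
    refine (measure_union_le _ _).trans
      ((add_le_add (ih (2 * k) (by omega) (by omega))
        (ih (2 * k + 1) (by omega) (by omega))).trans_eq ?_)
    rw [pow_succ]; ring

/-- Every cell has mass at least `ρ⁻¹ * 2 ^ (-K)`. -/
lemma QuasiDyadic.inv_div_le_measureReal {d K : ℕ} {P : Measure (Euc d)} [IsProbabilityMeasure P]
    {ρ : ℝ} (hρ : 1 ≤ ρ) (D : QuasiDyadic d P K ρ) {j k : ℕ} (hj : j ≤ K)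
    (hk : k < 2 ^ (K - j)) : ρ⁻¹ / 2 ^ K ≤ P.real (D.C j k) := by
  have hρ0 : 0 < ρ := by linarith
  have leaf (k' : ℕ) (hk' : k' < 2 ^ K) : ENNReal.ofReal (ρ⁻¹ / 2 ^ K) ≤ P (D.C 0 k') := by
    have h := D.measure_le (fun k hk => D.ratio k hk k' hk') K 0 le_rfl (by simp)
    rw [D.total] at h
    have h' : (1 : ℝ) ≤ 2 ^ K * (ρ * P.real (D.C 0 k')) := by
      have := ENNReal.toReal_mono (by finiteness) h
      simpa [ENNReal.toReal_mul, ENNReal.toReal_ofReal hρ0.le, Measure.real] using this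
    rw [ENNReal.ofReal_le_iff_le_toReal (by finiteness), div_le_iff₀ (by positivity),
      inv_le_iff_one_le_mul₀ hρ0]
    simp only [Measure.real] at h'
    linarith
  exact (ENNReal.ofReal_le_iff_le_toReal (by finiteness)).1 (D.le_measure leaf j k hj hk)

/-- A bound for the moment generating function of a centred Bernoulli variable, tilted. -/
lemma bernoulli_tilted_mgf_le {p c : ℝ} (hp : 0 ≤ p) (hp' : p ≤ 1) (hc : 0 < c) (hc' : c ≤ 1) :
    p * Real.exp (c * (1 - p - c)) + (1 - p) * Real.exp (c * (-p - c)) ≤ 1 - c ^ 2 / 3 := by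
  have key (y : ℝ) (hy : |y| ≤ 1) : Real.exp y ≤ 1 + y + y ^ 2 := by
    have := (abs_le.1 (Real.abs_exp_sub_one_sub_id_le hy)).2
    linarith
  have h1 := key (c * (1 - p)) (by rw [abs_le]; constructor <;> nlinarith)
  have h2 := key (-(c * p)) (by rw [abs_le]; constructor <;> nlinarith)
  have h3 : p * Real.exp (c * (1 - p)) + (1 - p) * Real.exp (-(c * p)) ≤ Real.exp (c ^ 2 / 4) := by
    refine le_trans ?_ (Real.add_one_le_exp _)
    have h1' := mul_le_mul_of_nonneg_left h1 hp
    have h2' := mul_le_mul_of_nonneg_left h2 (sub_nonneg.2 hp')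
    nlinarith [mul_nonneg (sq_nonneg c) (sq_nonneg (p - 1 / 2))]
  have h4 : Real.exp (-(3 * c ^ 2 / 4)) ≤ 1 - c ^ 2 / 3 := by
    have h5 := Real.add_one_le_exp (3 * c ^ 2 / 4)
    rw [Real.exp_neg, inv_le_iff_one_le_mul₀ (Real.exp_pos _)]
    have h6 : c ^ 2 ≤ 1 := by nlinarith
    nlinarith [mul_le_mul_of_nonneg_right h5 (by linarith : 0 ≤ 1 - c ^ 2 / 3),
      mul_nonneg (sq_nonneg c) (sub_nonneg.2 h6)]
  calc _ = Real.exp (-c ^ 2) *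
        (p * Real.exp (c * (1 - p)) + (1 - p) * Real.exp (-(c * p))) := by
        rw [show c * (1 - p - c) = -c ^ 2 + c * (1 - p) by ring,
          show c * (-p - c) = -c ^ 2 + -(c * p) by ring, Real.exp_add, Real.exp_add]
        ring
    _ ≤ Real.exp (-c ^ 2) * Real.exp (c ^ 2 / 4) := by gcongr
    _ = Real.exp (-(3 * c ^ 2 / 4)) := by rw [← Real.exp_add]; ring_nf
    _ ≤ _ := h4

/-- The number of points of a sample lying in a set, as a real number. -/
def sampleCount {E : Type*} {n : ℕ} (A : Set E) (y : Fin n → E) : ℝ :=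
  ∑ i, A.indicator (fun _ => (1 : ℝ)) (y i)

lemma measurable_sampleCount {E : Type*} [MeasurableSpace E] {n : ℕ} {A : Set E}
    (hA : MeasurableSet A) : Measurable (sampleCount (n := n) A) :=
  Finset.measurable_sum _ fun i _ =>
    (measurable_const.indicator hA).comp (measurable_pi_apply i)

/-- Upper tail bound for the count of a subset relative to the count of the set. -/
lemma measureReal_pi_sampleCount_le {E : Type*} [MeasurableSpace E] (P : Measure E)
    [IsProbabilityMeasure P] (n : ℕ) {A C : Set E} (hA : MeasurableSet A) (hC : MeasurableSet C)
    (hAC : A ⊆ C) (hpos : 0 < P.real C) {c : ℝ} (hc : 0 < c) (hc' : c ≤ 1) :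
    (Measure.pi fun _ : Fin n => P).real
      {y | c * sampleCount C y < sampleCount A y - P.real A / P.real C * sampleCount C y} ≤
      Real.exp (-(c ^ 2 / 3 * n * P.real C)) := by
  set q := P.real C with hq
  set p := P.real A / q with hp
  have hp0 : 0 ≤ p := by positivity
  have hp1 : p ≤ 1 := (div_le_one hpos).2 (measureReal_mono hAC)
  have hpq : P.real A = p * q := by rw [hp]; field_simp
  let g : E → ℝ := fun z =>
    Real.exp (c * (A.indicator (fun _ => 1) z - (p + c) * C.indicator (fun _ => 1) z))
  have hg : g = fun z => 1 + C.indicator (fun _ => Real.exp (c * (-p - c)) - 1) z +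
      A.indicator (fun _ => Real.exp (c * (1 - p - c)) - Real.exp (c * (-p - c))) z := by
    funext z
    by_cases hz : z ∈ A
    · have hz' := hAC hz
      simp only [g, Set.indicator_of_mem hz, Set.indicator_of_mem hz']
      ring_nf
    · by_cases hz' : z ∈ C
      · simp only [g, Set.indicator_of_notMem hz, Set.indicator_of_mem hz']
        ring_nf
      · simp [g, Set.indicator_of_notMem hz, Set.indicator_of_notMem hz']
  have hi1 : Integrable (fun z => 1 + C.indicator (fun _ => Real.exp (c * (-p - c)) - 1) z) P :=
    (integrable_const _).add ((integrable_const _).indicator hC)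
  have hi2 : Integrable (A.indicator
      (fun _ => Real.exp (c * (1 - p - c)) - Real.exp (c * (-p - c)))) P :=
    (integrable_const _).indicator hA
  have hgi : Integrable g P := by rw [hg]; exact hi1.add hi2
  have hint : ∫ z, g z ∂P ≤ Real.exp (-(c ^ 2 / 3 * q)) := by
    have hval : ∫ z, g z ∂P = 1 - q +
        q * (p * Real.exp (c * (1 - p - c)) + (1 - p) * Real.exp (c * (-p - c))) := by
      rw [hg, integral_add hi1 hi2,
        integral_add (integrable_const _) ((integrable_const _).indicator hC),
        integral_indicator_const _ hC, integral_indicator_const _ hA, hpq]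
      simp only [integral_const, probReal_univ, smul_eq_mul, ← hq]
      ring
    rw [hval]
    have := mul_le_mul_of_nonneg_left (bernoulli_tilted_mgf_le hp0 hp1 hc hc') hpos.le
    have := Real.add_one_le_exp (-(c ^ 2 / 3 * q))
    linarith
  have hprod (y : Fin n → E) :
      ∏ i, g (y i) = Real.exp (c * (sampleCount A y - (p + c) * sampleCount C y)) := by
    simp only [g, sampleCount, ← Real.exp_sum, ← Finset.mul_sum, Finset.sum_sub_distrib]
  have hmarkov := mul_meas_ge_le_integral_of_nonneg (μ := Measure.pi fun _ : Fin n => P)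
    (f := fun y => ∏ i, g (y i))
    (Eventually.of_forall fun y => Finset.prod_nonneg fun i _ => (Real.exp_pos _).le)
    (Integrable.fintype_prod (fun _ => hgi)) 1
  rw [one_mul, integral_fintype_prod_eq_pow] at hmarkov
  calc _ ≤ (Measure.pi fun _ : Fin n => P).real {y | 1 ≤ ∏ i, g (y i)} := by
        refine measureReal_mono fun y hy => ?_
        simp only [Set.mem_ofPred_eq, hprod, Real.one_le_exp_iff] at hy ⊢
        have : 0 ≤ sampleCount A y - (p + c) * sampleCount C y := by linarith
        positivity
    _ ≤ (∫ z, g z ∂P) ^ n := by simpa using hmarkov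
    _ ≤ Real.exp (-(c ^ 2 / 3 * q)) ^ n :=
        pow_le_pow_left₀ (integral_nonneg fun z => (Real.exp_pos _).le) hint n
    _ = _ := by rw [← Real.exp_nat_mul]; ring_nf

/-- Two-sided deviation bound for the split of a cell into two disjoint pieces. -/
lemma measureReal_pi_abs_sampleCount_le {E : Type*} [MeasurableSpace E] (P : Measure E)
    [IsProbabilityMeasure P] (n : ℕ) {A B : Set E} (hA : MeasurableSet A) (hB : MeasurableSet B)
    (hAB : Disjoint A B) (hpos : 0 < P.real (A ∪ B)) {c : ℝ} (hc : 0 < c) (hc' : c ≤ 1) :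
    (Measure.pi fun _ : Fin n => P).real
      {y | c * sampleCount (A ∪ B) y <
        |sampleCount A y - P.real A / P.real (A ∪ B) * sampleCount (A ∪ B) y|} ≤
      2 * Real.exp (-(c ^ 2 / 3 * n * P.real (A ∪ B))) := by
  have h1 := measureReal_pi_sampleCount_le P n hA (hA.union hB) Set.subset_union_left hpos hc hc'
  have h2 := measureReal_pi_sampleCount_le P n hB (hA.union hB) Set.subset_union_right hpos hc hc'
  rw [two_mul]
  refine (measureReal_mono ?_).trans ((measureReal_union_le _ _).trans (add_le_add h1 h2))
  intro y hy
  have hsum : sampleCount (A ∪ B) y = sampleCount A y + sampleCount B y := by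
    simp only [sampleCount, Set.indicator_union_of_disjoint hAB, Finset.sum_add_distrib]
  have hfrac : P.real A / P.real (A ∪ B) + P.real B / P.real (A ∪ B) = 1 := by
    rw [← add_div, ← measureReal_union hAB hB, div_self hpos.ne']
  rw [Set.mem_ofPred_eq] at hy
  rcases lt_abs.1 hy with h | h
  · exact Or.inl h
  · refine Or.inr (h.trans_eq ?_)
    rw [eq_sub_of_add_eq' hfrac]
    linear_combination hsum

/-- Concentration of the cell counts of an i.i.d. sample along a quasi-dyadic
expansion: with `U_{j,k}` the number of sample points in `C_{j,k}` and
`p_{j,k} = P(C_{j-1,2k})/P(C_{j,k})`, for every `c₁ ∈ (0,1]`,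
`P(∃ (j,k) ∈ I_K, |U_{j-1,2k} - p_{j,k} U_{j,k}| > c₁ U_{j,k})
  ≤ 3 · 2^K · exp(-min{c₁²/3, 1/8} ρ⁻¹ n 2^{-K})`. -/
theorem statement_8 (d K n : ℕ) (ρ : ℝ) (hρ : 1 ≤ ρ)
    (P : Measure (Euc d)) (hP : IsProbabilityMeasure P)
    (D : QuasiDyadic d P K ρ)
    (Ω : Type) (mΩ : MeasurableSpace Ω) (Pr : Measure Ω) (hPr : IsProbabilityMeasure Pr)
    (x : Fin n → Ω → Euc d)
    (hiid : Measure.map (fun ω i => x i ω) Pr = Measure.pi (fun _ : Fin n => P))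
    (c₁ : ℝ) (hc₁ : 0 < c₁) (hc₁' : c₁ ≤ 1) :
    Pr {ω | ∃ j k : ℕ, 1 ≤ j ∧ j ≤ K ∧ k < 2 ^ (K - j) ∧
        c₁ * (∑ i, Set.indicator (D.C j k) (fun _ => (1 : ℝ)) (x i ω)) <
          |(∑ i, Set.indicator (D.C (j - 1) (2 * k)) (fun _ => (1 : ℝ)) (x i ω)) -
            (P (D.C (j - 1) (2 * k))).toReal / (P (D.C j k)).toReal *
              (∑ i, Set.indicator (D.C j k) (fun _ => (1 : ℝ)) (x i ω))|} ≤
      ENNReal.ofReal (3 * 2 ^ K *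
        Real.exp (-(min (c₁ ^ 2 / 3) (1 / 8) * ρ⁻¹ * n / 2 ^ K))) := by
  set b : ℝ := 2 * Real.exp (-(min (c₁ ^ 2 / 3) (1 / 8) * ρ⁻¹ * n / 2 ^ K)) with hb
  have hae : AEMeasurable (fun ω i => x i ω) Pr := by
    by_contra h
    rw [Measure.map_of_not_aemeasurable h] at hiid
    exact IsProbabilityMeasure.ne_zero _ hiid.symm
  let bad : ℕ × ℕ → Set (Fin n → Euc d) := fun s =>
    {y | c₁ * sampleCount (D.C s.1 s.2) y <
      |sampleCount (D.C (s.1 - 1) (2 * s.2)) y -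
        P.real (D.C (s.1 - 1) (2 * s.2)) / P.real (D.C s.1 s.2) * sampleCount (D.C s.1 s.2) y|}
  have hbad (s : ℕ × ℕ) : MeasurableSet (bad s) := by
    have h1 := measurable_sampleCount (n := n) (D.meas s.1 s.2)
    have h2 := measurable_sampleCount (n := n) (D.meas (s.1 - 1) (2 * s.2))
    exact measurableSet_lt (h1.const_mul _) (h2.sub (h1.const_mul _)).norm
  have hcell (j k : ℕ) (hj : 1 ≤ j) (hjK : j ≤ K) (hk : k < 2 ^ (K - j)) :
      Pr ((fun ω i => x i ω) ⁻¹' bad (j, k)) ≤ ENNReal.ofReal b := by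
    rw [← Measure.map_apply_of_aemeasurable hae (hbad _), hiid,
      ENNReal.le_ofReal_iff_toReal_le (by finiteness) (by positivity)]
    have hq := D.inv_div_le_measureReal hρ hjK hk
    have hpos : 0 < P.real (D.C j k) := lt_of_lt_of_le (by positivity) hq
    have hU := D.union j k hj hjK hk
    have hdev := measureReal_pi_abs_sampleCount_le P n (D.meas (j - 1) (2 * k))
      (D.meas (j - 1) (2 * k + 1)) (D.disj j k hj hjK hk) (hU ▸ hpos) hc₁ hc₁'
    rw [← hU] at hdev
    refine hdev.trans ?_
    rw [hb]
    gcongr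
    calc min (c₁ ^ 2 / 3) (1 / 8) * ρ⁻¹ * n / 2 ^ K
        = min (c₁ ^ 2 / 3) (1 / 8) * n * (ρ⁻¹ / 2 ^ K) := by ring
      _ ≤ c₁ ^ 2 / 3 * n * P.real (D.C j k) := by
        gcongr
        exact min_le_left _ _
  have hcard : ∑ j ∈ Finset.Icc 1 K, 2 ^ (K - j) ≤ 2 ^ K := by
    have hflip : ∑ j ∈ Finset.Icc 1 K, 2 ^ (K - j) = ∑ i ∈ Finset.range K, 2 ^ i :=
      Finset.sum_nbij' (K - ·) (K - ·) (by simp; omega) (by simp; omega) (by simp; omega)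
        (by simp; omega) (by simp)
    rw [hflip]
    exact (Nat.geomSum_lt le_rfl (by simp)).le
  calc _ ≤ Pr (⋃ j ∈ Finset.Icc 1 K, ⋃ k ∈ Finset.range (2 ^ (K - j)),
          (fun ω i => x i ω) ⁻¹' bad (j, k)) := by
        refine measure_mono ?_
        rintro ω ⟨j, k, hj, hjK, hk, h⟩
        simp only [Set.mem_iUnion, Finset.mem_Icc, Finset.mem_range]
        exact ⟨j, ⟨hj, hjK⟩, k, hk, h⟩
    _ ≤ ∑ j ∈ Finset.Icc 1 K, ∑ k ∈ Finset.range (2 ^ (K - j)), ENNReal.ofReal b := by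
        refine (measure_biUnion_finset_le _ _).trans (Finset.sum_le_sum fun j hj => ?_)
        refine (measure_biUnion_finset_le _ _).trans (Finset.sum_le_sum fun k hk => ?_)
        rw [Finset.mem_Icc] at hj
        exact hcell j k hj.1 hj.2 (Finset.mem_range.1 hk)
    _ = ((∑ j ∈ Finset.Icc 1 K, 2 ^ (K - j) : ℕ) : ℝ≥0∞) * ENNReal.ofReal b := by
        simp [Finset.sum_mul]
    _ ≤ ((2 ^ K : ℕ) : ℝ≥0∞) * ENNReal.ofReal b := by gcongr
    _ = ENNReal.ofReal (2 ^ K * b) := by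
        rw [ENNReal.ofReal_mul (p := 2 ^ K) (by positivity), ← ENNReal.ofReal_natCast, Nat.cast_pow,
          Nat.cast_ofNat]
    _ ≤ _ := by
        refine ENNReal.ofReal_le_ofReal ?_
        rw [hb, ← mul_assoc, mul_comm (2 ^ K) (2 : ℝ)]
        gcongr
        norm_num
end
end

section
/- Let P be a probability measure on ℝ^d with a Lebesgue density f satisfying f̄ := sup_x f(x) < ∞, and let {C_{j,k}} be a dyadic expansion of depth K with respect to P (so P(C_{0,k}) = 2^{−K} for all terminal cells). Let V = ∪_{0≤k<2^K} (C_{0,k} − C_{0,k}) be the set of all differences u − v with u, v lying in a common terminal cell; assume V is Borel with Lebesgue measure λ(V) < ∞ and s̄ := sup_{s∈V} ‖s‖₂ < ∞. Then for every bounded continuously differentiable h : ℝ^d → ℝ with ∫_{ℝ^d} ‖∇h(x)‖₂ dx < ∞, and x₁ ~ P: E[ |h(x₁) − Π₀h(x₁)| ] ≤ f̄² · 2^K · λ(V) · s̄ · ∫_{ℝ^d} ‖∇h(x)‖₂ dx. -/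
open MeasureTheory ProbabilityTheory Filter
open scoped ENNReal NNReal BigOperators Pointwise Classical

noncomputable section

/-- The `L²(P)`-projection `Π₀ h` of `h` onto functions constant on the terminal cells. -/
def proj0 {d : ℕ} (P : Measure (Euc d)) (Cf : ℕ → ℕ → Set (Euc d)) (K : ℕ)
    (h : Euc d → ℝ) : Euc d → ℝ :=
  fun x => ∑ k ∈ Finset.range (2 ^ K),
    Set.indicator (Cf 0 k) (fun _ => (∫ y in Cf 0 k, h y ∂P) / (P (Cf 0 k)).toReal) x

/-- The cells of a fixed level of an expansion are pairwise disjoint. -/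
theorem QuasiDyadic.disjoint_level {d K : ℕ} {P : Measure (Euc d)} {ρ : ℝ}
    (D : QuasiDyadic d P K ρ) (i : ℕ) (hi : i ≤ K) :
    ∀ k < 2 ^ i, ∀ l < 2 ^ i, k ≠ l → Disjoint (D.C (K - i) k) (D.C (K - i) l) := by
  induction i with
  | zero => intro k hk l hl hkl; simp at hk hl; omega
  | succ i ih =>
    intro k hk l hl hkl
    have e : K - (i + 1) = K - i - 1 := by omega
    have e2 : K - (K - i) = i := by omega
    have hk2 : k / 2 < 2 ^ i := by rw [pow_succ] at hk; omega
    have hl2 : l / 2 < 2 ^ i := by rw [pow_succ] at hl; omega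
    have sub (m : ℕ) (hm : m / 2 < 2 ^ i) : D.C (K - (i + 1)) m ⊆ D.C (K - i) (m / 2) := by
      rw [D.union (K - i) (m / 2) (by omega) (by omega) (by rwa [e2]), e]
      rcases Nat.even_or_odd' m with ⟨c, hc | hc⟩
      · rw [show 2 * (m / 2) = m by omega]; exact Set.subset_union_left
      · rw [show 2 * (m / 2) + 1 = m by omega]; exact Set.subset_union_right
    by_cases hkl2 : k / 2 = l / 2
    · have := D.disj (K - i) (k / 2) (by omega) (by omega) (by rwa [e2])
      rw [e]
      rcases Nat.lt_or_gt_of_ne hkl with h1 | h1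
      · rwa [show 2 * (k / 2) = k by omega, show k + 1 = l by omega] at this
      · rw [show 2 * (k / 2) = l by omega, show l + 1 = k by omega] at this
        exact this.symm
    · exact (ih (by omega) _ hk2 _ hl2 hkl2).mono (sub k hk2) (sub l hl2)

/-- The cells of a fixed level of an expansion cover the root cell. -/
theorem QuasiDyadic.root_subset_level {d K : ℕ} {P : Measure (Euc d)} {ρ : ℝ}
    (D : QuasiDyadic d P K ρ) (i : ℕ) (hi : i ≤ K) :
    ∀ x ∈ D.C K 0, ∃ k < 2 ^ i, x ∈ D.C (K - i) k := by
  induction i with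
  | zero => intro x hx; exact ⟨0, by simp, by simpa using hx⟩
  | succ i ih =>
    intro x hx
    obtain ⟨k, hk, hxk⟩ := ih (by omega) x hx
    have e : K - (i + 1) = K - i - 1 := by omega
    rw [D.union (K - i) k (by omega) (by omega) (by rwa [show K - (K - i) = i by omega])] at hxk
    rcases hxk with hxk | hxk
    · exact ⟨2 * k, by rw [pow_succ]; omega, by rwa [e]⟩
    · exact ⟨2 * k + 1, by rw [pow_succ]; omega, by rwa [e]⟩

/-- The `L¹` modulus of continuity of a `C¹` function is controlled by its gradient. -/
theorem lintegral_enorm_add_sub_le {E : Type*} [NormedAddCommGroup E] [InnerProductSpace ℝ E]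
    [CompleteSpace E] [MeasurableSpace E] [BorelSpace E] [SecondCountableTopology E]
    (μ : Measure E) [SFinite μ] [μ.IsAddRightInvariant] {h : E → ℝ} (hC1 : ContDiff ℝ 1 h)
    (s : E) : ∫⁻ x, ‖h (x + s) - h x‖ₑ ∂μ ≤ ‖s‖ₑ * ∫⁻ x, ‖gradient h x‖ₑ ∂μ := by
  have hcont : Continuous (fun x => gradient h x) :=
    (InnerProductSpace.toDual ℝ E).symm.continuous.comp (hC1.continuous_fderiv one_ne_zero)
  have hpt (x : E) : ‖h (x + s) - h x‖ₑ ≤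
      ∫⁻ t in Set.Ioc (0 : ℝ) 1, ‖s‖ₑ * ‖gradient h (x + t • s)‖ₑ := by
    have hder (t : ℝ) : HasDerivAt (fun t : ℝ => h (x + t • s))
        (inner ℝ (gradient h (x + t • s)) s) t := by
      have h1 : HasDerivAt (fun t : ℝ => x + t • s) s t := by
        simpa using ((hasDerivAt_id t).smul_const s).const_add x
      have h2 := ((hC1.differentiable one_ne_zero) (x + t • s)).hasGradientAt.hasFDerivAt
      have h3 := h2.comp_hasDerivAt t h1
      rwa [InnerProductSpace.toDual_apply_apply] at h3
    have hint := intervalIntegral.integral_eq_sub_of_hasDerivAt (a := 0) (b := 1)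
      (fun t _ => hder t) (Continuous.intervalIntegrable (by fun_prop) _ _)
    simp only [one_smul, zero_smul, add_zero] at hint
    rw [← hint, intervalIntegral.integral_of_le zero_le_one]
    refine (enorm_integral_le_lintegral_enorm _).trans (lintegral_mono fun t => ?_)
    rw [mul_comm, ← ofReal_norm, ← ofReal_norm, ← ofReal_norm,
      ← ENNReal.ofReal_mul (norm_nonneg _)]
    exact ENNReal.ofReal_le_ofReal (norm_inner_le_norm _ _)
  calc ∫⁻ x, ‖h (x + s) - h x‖ₑ ∂μ
      ≤ ∫⁻ x, (∫⁻ t in Set.Ioc (0 : ℝ) 1, ‖s‖ₑ * ‖gradient h (x + t • s)‖ₑ) ∂μ :=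
        lintegral_mono hpt
    _ = ∫⁻ t in Set.Ioc (0 : ℝ) 1, ∫⁻ x, ‖s‖ₑ * ‖gradient h (x + t • s)‖ₑ ∂μ := by
        refine lintegral_lintegral_swap (Measurable.aemeasurable ?_)
        exact ((by fun_prop : Continuous fun z : E × ℝ =>
          gradient h (z.1 + z.2 • s)).measurable.enorm).const_mul _
    _ = ∫⁻ _ in Set.Ioc (0 : ℝ) 1, ‖s‖ₑ * ∫⁻ x, ‖gradient h x‖ₑ ∂μ := by
        refine lintegral_congr fun t => ?_
        rw [lintegral_const_mul' _ _ enorm_ne_top,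
          lintegral_add_right_eq_self (fun x => ‖gradient h x‖ₑ)]
    _ = ‖s‖ₑ * ∫⁻ x, ‖gradient h x‖ₑ ∂μ := by simp

/-- The distance to the average over a set is at most the average distance. -/
theorem enorm_sub_setIntegral_div_le {α : Type*} [MeasurableSpace α] {μ : Measure α}
    {A : Set α} (hA0 : μ A ≠ 0) (hA : μ A ≠ ⊤) {h : α → ℝ} (hh : IntegrableOn h A μ) (a : ℝ) :
    ‖a - (∫ y in A, h y ∂μ) / (μ A).toReal‖ₑ ≤ (μ A)⁻¹ * ∫⁻ y in A, ‖a - h y‖ₑ ∂μ := by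
  have hpos : 0 < (μ A).toReal := ENNReal.toReal_pos hA0 hA
  have hconst : IntegrableOn (fun _ => a) A μ := integrableOn_const hA
  have e : a - (∫ y in A, h y ∂μ) / (μ A).toReal =
      (μ A).toReal⁻¹ * ∫ y in A, (a - h y) ∂μ := by
    rw [integral_sub hconst hh, setIntegral_const, measureReal_def, smul_eq_mul]
    field_simp
  rw [e, enorm_mul, ← ENNReal.toReal_inv,
    Real.enorm_of_nonneg ENNReal.toReal_nonneg, ENNReal.ofReal_toReal (ENNReal.inv_ne_top.2 hA0)]
  gcongr
  exact enorm_integral_le_lintegral_enorm _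

/-- A sum of integrals over the squares of disjoint sets is at most the integral over all pairs
whose difference lies in `V`, written in terms of the difference variable. -/
theorem sum_setLIntegral_setLIntegral_le {E ι : Type*} [AddCommGroup E] [MeasurableSpace E]
    [MeasurableAdd₂ E] [MeasurableSub₂ E] (μ : Measure E) [SFinite μ] [μ.IsAddLeftInvariant]
    {S : Finset ι} {A : ι → Set E} (hA : ∀ i ∈ S, MeasurableSet (A i))
    (hdisj : (S : Set ι).PairwiseDisjoint A) {V : Set E} (hVm : MeasurableSet V)
    (hV : ∀ i ∈ S, A i - A i ⊆ V) {F : E → E → ℝ≥0∞} (hF : Measurable (Function.uncurry F)) :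
    ∑ i ∈ S, ∫⁻ x in A i, ∫⁻ y in A i, F x y ∂μ ∂μ ≤
      ∫⁻ s in V, ∫⁻ x, F x (x + s) ∂μ ∂μ := by
  have hFx (x : E) : Measurable (F x) := hF.comp measurable_prodMk_left
  have hcell (i : ι) (hi : i ∈ S) (x : E) (hx : x ∈ A i) :
      ∫⁻ y in A i, F x y ∂μ ≤ ∫⁻ s in V, F x (x + s) ∂μ := by
    rw [← lintegral_indicator (hA i hi), ← lintegral_indicator hVm,
      ← lintegral_add_left_eq_self _ x]
    refine lintegral_mono fun s => ?_
    by_cases hs : x + s ∈ A i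
    · have : s ∈ V := hV i hi ⟨x + s, hs, x, hx, by simp⟩
      simp [hs, this]
    · simp [hs]
  calc ∑ i ∈ S, ∫⁻ x in A i, ∫⁻ y in A i, F x y ∂μ ∂μ
      ≤ ∑ i ∈ S, ∫⁻ x in A i, ∫⁻ s in V, F x (x + s) ∂μ ∂μ :=
        Finset.sum_le_sum fun i hi => setLIntegral_mono' (hA i hi) (hcell i hi)
    _ = ∫⁻ x in ⋃ i ∈ S, A i, ∫⁻ s in V, F x (x + s) ∂μ ∂μ :=
        (lintegral_biUnion_finset hdisj hA _).symm
    _ ≤ ∫⁻ x, ∫⁻ s in V, F x (x + s) ∂μ ∂μ := setLIntegral_le_lintegral _ _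
    _ = ∫⁻ s in V, ∫⁻ x, F x (x + s) ∂μ ∂μ := by
        refine lintegral_lintegral_swap (Measurable.aemeasurable ?_)
        exact hF.comp (measurable_fst.prodMk (measurable_fst.add measurable_snd))

/-- A measure with density at most `c` is at most `c` times the base measure. -/
theorem withDensity_le_smul {α : Type*} [MeasurableSpace α] {μ : Measure α} {g : α → ℝ≥0∞}
    {c : ℝ≥0∞} (hg : ∀ x, g x ≤ c) : μ.withDensity g ≤ c • μ := by
  rw [← withDensity_const]
  exact withDensity_mono (ae_of_all _ hg)

/-- `L¹(P)`-projection error bound onto terminal cells of a dyadic expansion: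
`E[|h(x₁) - Π₀h(x₁)|] ≤ f̄² · 2^K · λ(V) · s̄ · ∫ ‖∇h‖₂`. -/
theorem statement_14 (d K : ℕ) (f : Euc d → ℝ) (fbar : ℝ)
    (hf : Measurable f) (hf0 : ∀ x, 0 ≤ f x) (hfbar : ∀ x, f x ≤ fbar)
    (P : Measure (Euc d)) (hPd : P = volume.withDensity (fun x => ENNReal.ofReal (f x)))
    (hP : IsProbabilityMeasure P)
    (D : QuasiDyadic d P K 1)
    (hdy : ∀ k, k < 2 ^ K → P (D.C 0 k) = ((2 : ℝ≥0∞) ^ K)⁻¹)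
    (V : Set (Euc d)) (hV : V = ⋃ k ∈ Finset.range (2 ^ K), (D.C 0 k - D.C 0 k))
    (hVmeas : MeasurableSet V) (hVfin : volume V < ⊤)
    (sbar : ℝ) (hsbar0 : 0 ≤ sbar) (hsbar : ∀ s ∈ V, ‖s‖ ≤ sbar)
    (h : Euc d → ℝ) (hC1 : ContDiff ℝ 1 h) (hbdd : ∃ B : ℝ, ∀ x, |h x| ≤ B)
    (hgrad : Integrable (fun x => ‖gradient h x‖)) :
    ∫ x, |h x - proj0 P D.C K h x| ∂P ≤
      fbar ^ 2 * 2 ^ K * (volume V).toReal * sbar * ∫ x, ‖gradient h x‖ := by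
  obtain ⟨B, hB⟩ := hbdd
  have hhc : Continuous h := hC1.continuous
  have hhP : Integrable h P :=
    Integrable.of_bound hhc.aestronglyMeasurable B (ae_of_all _ hB)
  have hfb : 0 ≤ fbar := (hf0 0).trans (hfbar 0)
  set c : ℝ≥0∞ := ENNReal.ofReal fbar with hc
  have hPle : P ≤ c • volume := by
    rw [hPd]
    exact withDensity_le_smul fun x => ENNReal.ofReal_le_ofReal (hfbar x)
  have hdisj : (Finset.range (2 ^ K) : Set ℕ).PairwiseDisjoint (D.C 0) := by
    intro k hk l hl hkl
    simpa [Function.onFun] using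
      D.disjoint_level K le_rfl k (by simpa using hk) l (by simpa using hl) hkl
  have hcover : ∀ᵐ x ∂P, x ∈ ⋃ k ∈ Finset.range (2 ^ K), D.C 0 k := by
    have : ∀ᵐ x ∂P, x ∈ D.C K 0 := (prob_compl_eq_zero_iff (D.meas K 0)).2 D.total
    filter_upwards [this] with x hx
    simpa using D.root_subset_level K le_rfl x hx
  have hproj (k : ℕ) (hk : k ∈ Finset.range (2 ^ K)) (x : Euc d) (hx : x ∈ D.C 0 k) :
      proj0 P D.C K h x = (∫ y in D.C 0 k, h y ∂P) / (P (D.C 0 k)).toReal := by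
    rw [proj0, Finset.sum_eq_single_of_mem k hk, Set.indicator_of_mem hx]
    intro l hl hlk
    exact Set.indicator_of_notMem (fun hxl => (hdisj hl hk hlk).le_bot ⟨hxl, hx⟩) _
  have hF : Measurable (Function.uncurry fun x y : Euc d => ‖h x - h y‖ₑ) := by
    unfold Function.uncurry
    exact (by fun_prop : Continuous fun z : Euc d × Euc d => h z.1 - h z.2).measurable.enorm
  have hcell (k : ℕ) (hk : k ∈ Finset.range (2 ^ K)) :
      ∫⁻ x in D.C 0 k, ‖h x - proj0 P D.C K h x‖ₑ ∂P ≤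
        2 ^ K * c ^ 2 * ∫⁻ x in D.C 0 k, ∫⁻ y in D.C 0 k, ‖h x - h y‖ₑ := by
    have hPk := hdy k (Finset.mem_range.1 hk)
    have hrest : P.restrict (D.C 0 k) ≤ c • volume.restrict (D.C 0 k) :=
      (Measure.restrict_mono_measure hPle _).trans_eq (Measure.restrict_smul _ _ _)
    have hle (g : Euc d → ℝ≥0∞) :
        ∫⁻ x in D.C 0 k, g x ∂P ≤ c * ∫⁻ x in D.C 0 k, g x :=
      (lintegral_mono' hrest le_rfl).trans_eq (lintegral_smul_measure _ _)
    calc ∫⁻ x in D.C 0 k, ‖h x - proj0 P D.C K h x‖ₑ ∂P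
        ≤ ∫⁻ x in D.C 0 k, 2 ^ K * (c * ∫⁻ y in D.C 0 k, ‖h x - h y‖ₑ) ∂P := by
          refine setLIntegral_mono' (D.meas 0 k) fun x hx => ?_
          rw [hproj k hk x hx]
          refine (enorm_sub_setIntegral_div_le (D.pos k (Finset.mem_range.1 hk)).ne'
            (measure_ne_top _ _) hhP.integrableOn (h x)).trans ?_
          rw [hPk, inv_inv]
          gcongr
          exact hle _
      _ ≤ c * ∫⁻ x in D.C 0 k, 2 ^ K * (c * ∫⁻ y in D.C 0 k, ‖h x - h y‖ₑ) := hle _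
      _ = 2 ^ K * c ^ 2 * ∫⁻ x in D.C 0 k, ∫⁻ y in D.C 0 k, ‖h x - h y‖ₑ := by
          rw [lintegral_const_mul' _ _ (by finiteness),
            lintegral_const_mul' _ _ ENNReal.ofReal_ne_top]
          ring
  have hVsub (k : ℕ) (hk : k ∈ Finset.range (2 ^ K)) : D.C 0 k - D.C 0 k ⊆ V := by
    rw [hV]
    exact Set.subset_biUnion_of_mem (u := fun k => D.C 0 k - D.C 0 k) hk
  have hmain : ∫⁻ x, ‖h x - proj0 P D.C K h x‖ₑ ∂P ≤
      2 ^ K * c ^ 2 * (ENNReal.ofReal sbar * (∫⁻ x, ‖gradient h x‖ₑ) * volume V) := by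
    calc ∫⁻ x, ‖h x - proj0 P D.C K h x‖ₑ ∂P
        = ∫⁻ x in ⋃ k ∈ Finset.range (2 ^ K), D.C 0 k, ‖h x - proj0 P D.C K h x‖ₑ ∂P := by
          rw [Measure.restrict_eq_self_of_ae_mem hcover]
      _ = ∑ k ∈ Finset.range (2 ^ K), ∫⁻ x in D.C 0 k, ‖h x - proj0 P D.C K h x‖ₑ ∂P :=
          lintegral_biUnion_finset hdisj (fun k _ => D.meas 0 k) _
      _ ≤ ∑ k ∈ Finset.range (2 ^ K),
            2 ^ K * c ^ 2 * ∫⁻ x in D.C 0 k, ∫⁻ y in D.C 0 k, ‖h x - h y‖ₑ :=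
          Finset.sum_le_sum hcell
      _ ≤ 2 ^ K * c ^ 2 * ∫⁻ s in V, ∫⁻ x, ‖h x - h (x + s)‖ₑ := by
          rw [← Finset.mul_sum]
          gcongr
          exact sum_setLIntegral_setLIntegral_le volume (fun k _ => D.meas 0 k) hdisj hVmeas
            hVsub hF
      _ ≤ 2 ^ K * c ^ 2 * ∫⁻ _ in V, ENNReal.ofReal sbar * ∫⁻ x, ‖gradient h x‖ₑ := by
          gcongr 2 ^ K * c ^ 2 * ?_
          refine setLIntegral_mono' hVmeas fun s hs => ?_
          simp_rw [enorm_sub_rev (h _) (h (_ + s))]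
          refine (lintegral_enorm_add_sub_le volume hC1 s).trans ?_
          gcongr
          rw [← ofReal_norm]
          exact ENNReal.ofReal_le_ofReal (hsbar s hs)
      _ = _ := by rw [setLIntegral_const]
  have hgradE : ∫⁻ x, ‖gradient h x‖ₑ = ENNReal.ofReal (∫ x, ‖gradient h x‖) := by
    rw [ofReal_integral_eq_lintegral_ofReal hgrad (ae_of_all _ fun _ => norm_nonneg _)]
    simp_rw [ofReal_norm]
  have hI : 0 ≤ ∫ x, ‖gradient h x‖ := integral_nonneg fun _ => norm_nonneg _
  have hfin : 2 ^ K * c ^ 2 * (ENNReal.ofReal sbar * (∫⁻ x, ‖gradient h x‖ₑ) * volume V) ≠ ⊤ := by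
    rw [hgradE]
    finiteness
  calc ∫ x, |h x - proj0 P D.C K h x| ∂P
      ≤ (∫⁻ x, ‖h x - proj0 P D.C K h x‖ₑ ∂P).toReal := by
        simp_rw [← ofReal_norm]
        refine (Real.le_norm_self _).trans ((norm_integral_le_lintegral_norm _).trans_eq ?_)
        simp_rw [Real.norm_eq_abs, abs_abs]
    _ ≤ _ := ENNReal.toReal_mono hfin hmain
    _ = _ := by
        rw [hgradE]
        simp only [ENNReal.toReal_mul, ENNReal.toReal_pow, hc, ENNReal.toReal_ofReal hfb,
          ENNReal.toReal_ofReal hsbar0, ENNReal.toReal_ofReal hI, ENNReal.toReal_ofNat]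
        ring
end
end

section
/- Let P be a probability measure on ℝ^d with Lebesgue density f, f̄ := sup_x f(x) < ∞, and let {C_{j,k}} be a dyadic expansion of depth K with respect to P. For 1 ≤ j ≤ K define the j-th level difference set U_j = ∪_{0≤k<2^{K−j}} (C_{j−1,2k+1} − C_{j−1,2k}) (all differences u − v with u ∈ C_{j−1,2k+1}, v ∈ C_{j−1,2k} for some k), assumed Borel, and set s̄_j = sup_{s∈U_j} ‖s‖₂. Then for every bounded continuously differentiable h : ℝ^d → ℝ with ∫_{ℝ^d} ‖∇h‖₂ < ∞: (a) Σ_{0≤k<2^{K−j}} |β̃_{j,k}(h)| ≤ 4 · f̄² · 2^{2(K−j)} · λ(U_j) · s̄_j · ∫_{ℝ^d} ‖∇h(x)‖₂ dx; and (b) |β̃_{j,k}(h)| ≤ min{ 2·sup_x|h(x)|, Lip(h)·s̄_j } for every k, where Lip(h) is the Lipschitz constant of h with respect to the Euclidean norm. -/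
open MeasureTheory ProbabilityTheory Filter
open scoped ENNReal NNReal BigOperators Pointwise Classical

noncomputable section

/-- The cell average `β_{j,k}(h) = P(C_{j,k})⁻¹ ∫_{C_{j,k}} h dP`. -/
def betaC {d : ℕ} (P : Measure (Euc d)) (Cf : ℕ → ℕ → Set (Euc d)) (j k : ℕ)
    (h : Euc d → ℝ) : ℝ :=
  (∫ y in Cf j k, h y ∂P) / (P (Cf j k)).toReal

/-- The Haar coefficient `β̃_{j,k}(h) = β_{j-1,2k}(h) - β_{j-1,2k+1}(h)`. -/
def betaT {d : ℕ} (P : Measure (Euc d)) (Cf : ℕ → ℕ → Set (Euc d)) (j k : ℕ)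
    (h : Euc d → ℝ) : ℝ :=
  betaC P Cf (j - 1) (2 * k) h - betaC P Cf (j - 1) (2 * k + 1) h

namespace QuasiDyadic

variable {d K : ℕ} {P : Measure (Euc d)} {ρ : ℝ}

theorem child_subset (D : QuasiDyadic d P K ρ) {i k : ℕ} (hi : i < K) (hk : k < 2 ^ (K - i)) :
    D.C i k ⊆ D.C (i + 1) (k / 2) := by
  have e : K - i = (K - (i + 1)) + 1 := by omega
  rw [e, pow_succ] at hk
  have hu := D.union (i + 1) (k / 2) (by omega) hi (by omega)
  rw [Nat.add_sub_cancel] at hu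
  rw [hu]
  rcases Nat.mod_two_eq_zero_or_one k with h0 | h0
  · rw [show 2 * (k / 2) = k by omega]
    exact Set.subset_union_left
  · rw [show 2 * (k / 2) + 1 = k by omega]
    exact Set.subset_union_right

theorem disjoint_of_ne (D : QuasiDyadic d P K ρ) {i : ℕ} (hi : i ≤ K) :
    ∀ k < 2 ^ (K - i), ∀ l < 2 ^ (K - i), k ≠ l → Disjoint (D.C i k) (D.C i l) := by
  induction hi using Nat.decreasingInduction with
  | self => intro k hk l hl hkl; simp only [Nat.sub_self, pow_zero] at hk hl; omega
  | of_succ i hi ih =>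
    intro k hk l hl hkl
    have e : 2 ^ (K - i) = 2 ^ (K - (i + 1)) * 2 := by
      rw [← pow_succ]; congr 1; omega
    by_cases hp : k / 2 = l / 2
    · have hd := D.disj (i + 1) (k / 2) (by omega) hi (by omega)
      rw [Nat.add_sub_cancel] at hd
      rcases Nat.mod_two_eq_zero_or_one k with h0 | h0
      · rw [show 2 * (k / 2) + 1 = l by omega, show 2 * (k / 2) = k by omega] at hd
        exact hd
      · rw [show 2 * (k / 2) + 1 = k by omega, show 2 * (k / 2) = l by omega] at hd
        exact hd.symm
    · exact (ih _ (by omega) _ (by omega) hp).mono (D.child_subset hi hk) (D.child_subset hi hl)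

theorem measure_cell (D : QuasiDyadic d P K ρ)
    (hdy : ∀ k, k < 2 ^ K → P (D.C 0 k) = ((2 : ℝ≥0∞) ^ K)⁻¹) :
    ∀ i ≤ K, ∀ k < 2 ^ (K - i), P (D.C i k) = ((2 : ℝ≥0∞) ^ (K - i))⁻¹ := by
  intro i
  induction i with
  | zero => intro _ k hk; exact hdy k hk
  | succ i ih =>
    intro hi k hk
    have e : K - i = (K - (i + 1)) + 1 := by omega
    have hu := D.union (i + 1) k (by omega) hi hk
    have hd := D.disj (i + 1) k (by omega) hi hk
    rw [Nat.add_sub_cancel] at hu hd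
    have e' : 2 ^ (K - i) = 2 ^ (K - (i + 1)) * 2 := by rw [← pow_succ, e]
    rw [hu, measure_union hd (D.meas _ _), ih (by omega) _ (by omega), ih (by omega) _ (by omega),
      e, pow_succ, ENNReal.mul_inv (by simp) (by simp), ← mul_add, ENNReal.inv_two_add_inv_two,
      mul_one]

end QuasiDyadic

theorem lintegral_enorm_sub_translate_le {E : Type*} [NormedAddCommGroup E] [NormedSpace ℝ E]
    [FiniteDimensional ℝ E] [MeasurableSpace E] [BorelSpace E] (μ : Measure E) [μ.IsAddHaarMeasure]
    {h : E → ℝ} (hC1 : ContDiff ℝ 1 h) (s : E) :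
    ∫⁻ x, ‖h (x + s) - h x‖ₑ ∂μ ≤ ‖s‖ₑ * ∫⁻ x, ‖fderiv ℝ h x‖ₑ ∂μ := by
  have hc : Continuous (fderiv ℝ h) := hC1.continuous_fderiv one_ne_zero
  have hpt : ∀ x, ‖h (x + s) - h x‖ₑ
      ≤ ∫⁻ t in Set.Ioc (0 : ℝ) 1, ‖fderiv ℝ h (x + t • s)‖ₑ * ‖s‖ₑ := by
    intro x
    have hd : ∀ t : ℝ, HasDerivAt (fun t : ℝ => h (x + t • s)) (fderiv ℝ h (x + t • s) s) t := by
      intro t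
      have h1 : HasDerivAt (fun t : ℝ => x + t • s) s t := by
        simpa using ((hasDerivAt_id t).smul_const s).const_add x
      exact ((hC1.differentiable one_ne_zero _).hasFDerivAt).comp_hasDerivAt t h1
    have hi : Continuous fun t : ℝ => fderiv ℝ h (x + t • s) s := by fun_prop
    have hI := intervalIntegral.integral_eq_sub_of_hasDerivAt (a := 0) (b := 1)
      (fun t _ => hd t) (hi.intervalIntegrable _ _)
    simp only [one_smul, zero_smul, add_zero] at hI
    rw [← hI, intervalIntegral.integral_of_le zero_le_one]
    exact (enorm_integral_le_lintegral_enorm _).trans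
      (lintegral_mono fun t => ContinuousLinearMap.le_opENorm _ _)
  calc ∫⁻ x, ‖h (x + s) - h x‖ₑ ∂μ
      ≤ ∫⁻ x, (∫⁻ t in Set.Ioc (0 : ℝ) 1, ‖fderiv ℝ h (x + t • s)‖ₑ * ‖s‖ₑ) ∂μ := lintegral_mono hpt
    _ = ∫⁻ t in Set.Ioc (0 : ℝ) 1, ∫⁻ x, ‖fderiv ℝ h (x + t • s)‖ₑ * ‖s‖ₑ ∂μ := by
        refine lintegral_lintegral_swap (Continuous.measurable ?_).aemeasurable
        have hu : Continuous fun q : E × ℝ => ‖fderiv ℝ h (q.1 + q.2 • s)‖ₑ := by fun_prop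
        exact (ENNReal.continuous_mul_const enorm_ne_top).comp hu
    _ = ∫⁻ _ in Set.Ioc (0 : ℝ) 1, ‖s‖ₑ * ∫⁻ x, ‖fderiv ℝ h x‖ₑ ∂μ := by
        refine lintegral_congr fun t => ?_
        rw [lintegral_mul_const' _ _ enorm_ne_top,
          lintegral_add_right_eq_self (fun x => ‖fderiv ℝ h x‖ₑ), mul_comm]
    _ = ‖s‖ₑ * ∫⁻ x, ‖fderiv ℝ h x‖ₑ ∂μ := by simp

theorem setLIntegral_enorm_sub_le {E : Type*} [NormedAddCommGroup E] [NormedSpace ℝ E]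
    [FiniteDimensional ℝ E] [MeasurableSpace E] [BorelSpace E] (μ : Measure E) [μ.IsAddHaarMeasure]
    {h : E → ℝ} (hC1 : ContDiff ℝ 1 h) {U : Set E} (hU : MeasurableSet U) {r : ℝ}
    (hr : ∀ s ∈ U, ‖s‖ ≤ r) :
    ∫⁻ x, ∫⁻ y, U.indicator 1 (y - x) * ‖h x - h y‖ₑ ∂μ ∂μ
      ≤ μ U * (ENNReal.ofReal r * ∫⁻ x, ‖fderiv ℝ h x‖ₑ ∂μ) := by
  have hm : Measurable h := hC1.continuous.measurable
  have h1 : Measurable (U.indicator (1 : E → ℝ≥0∞)) := measurable_one.indicator hU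
  calc ∫⁻ x, ∫⁻ y, U.indicator 1 (y - x) * ‖h x - h y‖ₑ ∂μ ∂μ
      = ∫⁻ x, ∫⁻ s, U.indicator 1 s * ‖h (x + s) - h x‖ₑ ∂μ ∂μ := by
        refine lintegral_congr fun x => ?_
        rw [← lintegral_add_left_eq_self _ x]
        simp [enorm_sub_rev]
    _ = ∫⁻ s, ∫⁻ x, U.indicator 1 s * ‖h (x + s) - h x‖ₑ ∂μ ∂μ := by
        refine lintegral_lintegral_swap (Measurable.aemeasurable ?_)
        unfold Function.uncurry
        fun_prop
    _ = ∫⁻ s, U.indicator (fun s => ∫⁻ x, ‖h (x + s) - h x‖ₑ ∂μ) s ∂μ := by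
        refine lintegral_congr fun s => ?_
        by_cases hs : s ∈ U <;> simp [hs]
    _ ≤ ∫⁻ s, U.indicator (fun _ => ENNReal.ofReal r * ∫⁻ x, ‖fderiv ℝ h x‖ₑ ∂μ) s ∂μ := by
        refine lintegral_mono fun s => Set.indicator_le_indicator' fun hs => ?_
        refine (lintegral_enorm_sub_translate_le μ hC1 s).trans ?_
        gcongr
        rw [← ofReal_norm]
        exact ENNReal.ofReal_le_ofReal (hr s hs)
    _ = μ U * (ENNReal.ofReal r * ∫⁻ x, ‖fderiv ℝ h x‖ₑ ∂μ) := by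
        rw [lintegral_indicator_const hU, mul_comm]

theorem norm_gradient {E : Type*} [NormedAddCommGroup E] [InnerProductSpace ℝ E] [CompleteSpace E]
    (h : E → ℝ) (x : E) : ‖gradient h x‖ = ‖fderiv ℝ h x‖ := by
  rw [gradient, LinearIsometryEquiv.norm_map]

theorem betaT_eq_of_measure_eq {d : ℕ} {P : Measure (Euc d)} [IsFiniteMeasure P]
    {Cf : ℕ → ℕ → Set (Euc d)} {j k : ℕ} {h : Euc d → ℝ} (hh : Integrable h P) {p : ℝ}
    (hp : p ≠ 0) (h0 : P.real (Cf (j - 1) (2 * k)) = p)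
    (h1 : P.real (Cf (j - 1) (2 * k + 1)) = p) :
    betaT P Cf j k h = (p ^ 2)⁻¹ *
      ∫ x in Cf (j - 1) (2 * k), ∫ y in Cf (j - 1) (2 * k + 1), (h x - h y) ∂P ∂P := by
  have hin : ∀ x, ∫ y in Cf (j - 1) (2 * k + 1), (h x - h y) ∂P
      = p * h x - ∫ y in Cf (j - 1) (2 * k + 1), h y ∂P := by
    intro x
    rw [integral_sub (integrable_const _) hh.integrableOn, setIntegral_const, h1, smul_eq_mul]
  simp_rw [hin]
  rw [integral_sub (hh.integrableOn.const_mul _) (integrable_const _), setIntegral_const, h0,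
    integral_const_mul, betaT, betaC, betaC, smul_eq_mul]
  rw [measureReal_def] at h0 h1
  rw [h0, h1]
  field_simp

theorem enorm_setIntegral_setIntegral_sub_le {d : ℕ} (P : Measure (Euc d)) (h : Euc d → ℝ)
    (A B : Set (Euc d)) :
    ‖∫ x in A, ∫ y in B, (h x - h y) ∂P ∂P‖ₑ ≤ ∫⁻ x in A, ∫⁻ y in B, ‖h x - h y‖ₑ ∂P ∂P :=
  (enorm_integral_le_lintegral_enorm _).trans
    (lintegral_mono fun _ => enorm_integral_le_lintegral_enorm _)

theorem sum_setLIntegral_le {α : Type*} [MeasurableSpace α] [AddGroup α] (P : Measure α)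
    (g : α → α → ℝ≥0∞) (t : Finset ℕ) {A B : ℕ → Set α} (hA : ∀ k, MeasurableSet (A k))
    (hB : ∀ k, MeasurableSet (B k)) (hdis : (t : Set ℕ).PairwiseDisjoint A) {U : Set α}
    (hU : ∀ k ∈ t, ∀ x ∈ A k, ∀ y ∈ B k, y - x ∈ U) :
    ∑ k ∈ t, ∫⁻ x in A k, ∫⁻ y in B k, g x y ∂P ∂P
      ≤ ∫⁻ x, ∫⁻ y, U.indicator 1 (y - x) * g x y ∂P ∂P := by
  calc ∑ k ∈ t, ∫⁻ x in A k, ∫⁻ y in B k, g x y ∂P ∂P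
      ≤ ∑ k ∈ t, ∫⁻ x in A k, ∫⁻ y, U.indicator 1 (y - x) * g x y ∂P ∂P := by
        refine Finset.sum_le_sum fun k hk => setLIntegral_mono' (hA k) fun x hx => ?_
        refine (setLIntegral_mono' (hB k) fun y hy => ?_).trans (setLIntegral_le_lintegral _ _)
        simp [hU k hk x hx y hy]
    _ = ∫⁻ x in ⋃ k ∈ t, A k, ∫⁻ y, U.indicator 1 (y - x) * g x y ∂P ∂P :=
        (lintegral_biUnion_finset hdis (fun k _ => hA k) _).symm
    _ ≤ _ := setLIntegral_le_lintegral _ _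

theorem withDensity_ofReal_le_smul {α : Type*} [MeasurableSpace α] (μ : Measure α) {f : α → ℝ}
    {c : ℝ} (hc : ∀ x, f x ≤ c) :
    μ.withDensity (fun x => ENNReal.ofReal (f x)) ≤ ENNReal.ofReal c • μ := by
  rw [← withDensity_const]
  exact withDensity_mono (ae_of_all _ fun x => ENNReal.ofReal_le_ofReal (hc x))

theorem lintegral_lintegral_le_of_le_smul {α : Type*} [MeasurableSpace α] {P μ : Measure α}
    {c : ℝ≥0∞} (hc : c ≠ ∞) (hP : P ≤ c • μ) (g : α → α → ℝ≥0∞) :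
    ∫⁻ x, ∫⁻ y, g x y ∂P ∂P ≤ c ^ 2 * ∫⁻ x, ∫⁻ y, g x y ∂μ ∂μ := by
  have hle : ∀ u : α → ℝ≥0∞, ∫⁻ x, u x ∂P ≤ c * ∫⁻ x, u x ∂μ := fun u => by
    rw [← smul_eq_mul, ← lintegral_smul_measure]
    exact lintegral_mono' hP le_rfl
  calc ∫⁻ x, ∫⁻ y, g x y ∂P ∂P ≤ c * ∫⁻ x, ∫⁻ y, g x y ∂P ∂μ := hle _
    _ ≤ c * ∫⁻ x, c * ∫⁻ y, g x y ∂μ ∂μ := by gcongr; exact hle _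
    _ = _ := by rw [lintegral_const_mul' _ _ hc]; ring

/-- Bounds on the Haar coefficients `β̃_{j,k}(h)` along a dyadic expansion:
(a) `∑_k |β̃_{j,k}(h)| ≤ 4 f̄² 2^{2(K-j)} λ(U_j) s̄_j ∫‖∇h‖₂`, and
(b) `|β̃_{j,k}(h)| ≤ min{2 sup|h|, Lip(h) s̄_j}`. -/
theorem statement_16 (d K : ℕ) (f : Euc d → ℝ) (fbar : ℝ)
    (hf : Measurable f) (hf0 : ∀ x, 0 ≤ f x) (hfbar : ∀ x, f x ≤ fbar)
    (P : Measure (Euc d)) (hPd : P = volume.withDensity (fun x => ENNReal.ofReal (f x)))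
    (hP : IsProbabilityMeasure P)
    (D : QuasiDyadic d P K 1)
    (hdy : ∀ k, k < 2 ^ K → P (D.C 0 k) = ((2 : ℝ≥0∞) ^ K)⁻¹)
    (h : Euc d → ℝ) (hC1 : ContDiff ℝ 1 h) (hbdd : ∃ B : ℝ, ∀ x, |h x| ≤ B)
    (hgradInt : Integrable (fun x => ‖gradient h x‖)) :
    ∀ j : ℕ, 1 ≤ j → j ≤ K →
      ∀ Uj : Set (Euc d),
        Uj = ⋃ k ∈ Finset.range (2 ^ (K - j)), (D.C (j - 1) (2 * k + 1) - D.C (j - 1) (2 * k)) →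
        MeasurableSet Uj →
        ∀ sbarj : ℝ, (∀ s ∈ Uj, ‖s‖ ≤ sbarj) →
          ((∑ k ∈ Finset.range (2 ^ (K - j)), |betaT P D.C j k h|) ≤
            4 * fbar ^ 2 * 2 ^ (2 * (K - j)) * (volume Uj).toReal * sbarj *
              ∫ x, ‖gradient h x‖) ∧
          (∀ Mh Lh : ℝ, (∀ x, |h x| ≤ Mh) → (∀ x y, |h x - h y| ≤ Lh * ‖x - y‖) →
            ∀ k : ℕ, k < 2 ^ (K - j) →
              |betaT P D.C j k h| ≤ min (2 * Mh) (Lh * sbarj)) := by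
  intro j hj hjK U hUdef hU s hs
  have hcard : K - (j - 1) = (K - j) + 1 := by omega
  have hlt : ∀ k < 2 ^ (K - j), 2 * k < 2 ^ (K - (j - 1)) ∧ 2 * k + 1 < 2 ^ (K - (j - 1)) := by
    intro k hk
    rw [hcard, pow_succ]
    omega
  set p : ℝ := ((2 : ℝ) ^ (K - j + 1))⁻¹ with hp
  have hp0 : 0 < p := by positivity
  have hcell : ∀ l < 2 ^ (K - (j - 1)), P.real (D.C (j - 1) l) = p := by
    intro l hl
    rw [measureReal_def, D.measure_cell hdy (j - 1) (by omega) l hl, hcard]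
    simp [hp]
  have hmem : ∀ k < 2 ^ (K - j), ∀ x ∈ D.C (j - 1) (2 * k), ∀ y ∈ D.C (j - 1) (2 * k + 1),
      y - x ∈ U := by
    intro k hk x hx y hy
    rw [hUdef]
    exact Set.mem_biUnion (Finset.mem_coe.2 (Finset.mem_range.2 hk)) (Set.sub_mem_sub hy hx)
  have hne : ∀ l < 2 ^ (K - (j - 1)), (D.C (j - 1) l).Nonempty := by
    intro l hl
    rw [Set.nonempty_iff_ne_empty]
    intro he
    have := hcell l hl
    rw [he, measureReal_empty] at this
    exact hp0.ne this
  have hs0 : 0 ≤ s := by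
    obtain ⟨x, hx⟩ := hne _ (hlt 0 (by positivity)).1
    obtain ⟨y, hy⟩ := hne _ (hlt 0 (by positivity)).2
    exact (norm_nonneg _).trans (hs _ (hmem 0 (by positivity) x hx y hy))
  have hint : Integrable h P := by
    obtain ⟨B, hB⟩ := hbdd
    exact Integrable.of_bound hC1.continuous.aestronglyMeasurable B (ae_of_all _ hB)
  have hbeta : ∀ k < 2 ^ (K - j), betaT P D.C j k h = (p ^ 2)⁻¹ *
      ∫ x in D.C (j - 1) (2 * k), ∫ y in D.C (j - 1) (2 * k + 1), (h x - h y) ∂P ∂P :=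
    fun k hk => betaT_eq_of_measure_eq hint hp0.ne' (hcell _ (hlt k hk).1) (hcell _ (hlt k hk).2)
  refine ⟨?_, ?_⟩
  · have hUfin : volume U ≠ ∞ :=
      ((measure_mono fun x hx => mem_closedBall_zero_iff.2 (hs x hx)).trans_lt
        (measure_closedBall_lt_top (x := (0 : Euc d)) (r := s))).ne
    have hfb : 0 ≤ fbar := (hf0 0).trans (hfbar 0)
    have hG0 : 0 ≤ ∫ x, ‖gradient h x‖ := integral_nonneg fun _ => norm_nonneg _
    have hG : ∫⁻ x, ‖fderiv ℝ h x‖ₑ = ENNReal.ofReal (∫ x, ‖gradient h x‖) := by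
      rw [ofReal_integral_eq_lintegral_ofReal hgradInt (ae_of_all _ fun _ => norm_nonneg _)]
      simp_rw [norm_gradient, ofReal_norm]
    have hsum : ∑ k ∈ Finset.range (2 ^ (K - j)),
        ∫⁻ x in D.C (j - 1) (2 * k), ∫⁻ y in D.C (j - 1) (2 * k + 1), ‖h x - h y‖ₑ ∂P ∂P
        ≤ ENNReal.ofReal (fbar ^ 2 * ((volume U).toReal * (s * ∫ x, ‖gradient h x‖))) := by
      refine (sum_setLIntegral_le P (fun x y => ‖h x - h y‖ₑ) _ (fun k => D.meas _ (2 * k))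
        (fun k => D.meas _ (2 * k + 1)) ?_ (U := U)
        (fun k hk => hmem k (Finset.mem_range.1 hk))).trans ?_
      · intro k hk l hl hkl
        exact D.disjoint_of_ne (by omega) _ (hlt k (by simpa using hk)).1 _
          (hlt l (by simpa using hl)).1 (by omega)
      · refine (lintegral_lintegral_le_of_le_smul ENNReal.ofReal_ne_top
          (hPd.le.trans (withDensity_ofReal_le_smul volume hfbar)) _).trans ?_
        rw [ENNReal.ofReal_mul (by positivity), ENNReal.ofReal_mul (by positivity),
          ENNReal.ofReal_mul hs0, ENNReal.ofReal_pow hfb, ENNReal.ofReal_toReal hUfin, ← hG]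
        gcongr
        exact setLIntegral_enorm_sub_le volume hC1 hU hs
    have hsum' : ∑ k ∈ Finset.range (2 ^ (K - j)),
        |∫ x in D.C (j - 1) (2 * k), ∫ y in D.C (j - 1) (2 * k + 1), (h x - h y) ∂P ∂P|
        ≤ fbar ^ 2 * ((volume U).toReal * (s * ∫ x, ‖gradient h x‖)) := by
      rw [← ENNReal.ofReal_le_ofReal_iff (by positivity),
        ENNReal.ofReal_sum_of_nonneg fun _ _ => abs_nonneg _]
      refine (Finset.sum_le_sum fun k _ => ?_).trans hsum
      rw [← Real.norm_eq_abs, ofReal_norm]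
      exact enorm_setIntegral_setIntegral_sub_le P h _ _
    calc ∑ k ∈ Finset.range (2 ^ (K - j)), |betaT P D.C j k h|
        = (p ^ 2)⁻¹ * ∑ k ∈ Finset.range (2 ^ (K - j)),
          |∫ x in D.C (j - 1) (2 * k), ∫ y in D.C (j - 1) (2 * k + 1), (h x - h y) ∂P ∂P| := by
          rw [Finset.mul_sum]
          refine Finset.sum_congr rfl fun k hk => ?_
          rw [hbeta k (Finset.mem_range.1 hk), abs_mul, abs_of_pos (by positivity)]
      _ ≤ (p ^ 2)⁻¹ * (fbar ^ 2 * ((volume U).toReal * (s * ∫ x, ‖gradient h x‖))) := by gcongr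
      _ = _ := by
          rw [hp, inv_pow, inv_inv, pow_mul' 2 2 (K - j), pow_succ]
          ring
  · intro M L hM hL k hk
    obtain ⟨hA, hB⟩ := hlt k hk
    have hbound : ∀ c : ℝ, (∀ x ∈ D.C (j - 1) (2 * k), ∀ y ∈ D.C (j - 1) (2 * k + 1),
        |h x - h y| ≤ c) → |betaT P D.C j k h| ≤ c := by
      intro c hc
      have hI := norm_setIntegral_le_of_norm_le_const (μ := P) (s := D.C (j - 1) (2 * k))
        (f := fun x => ∫ y in D.C (j - 1) (2 * k + 1), (h x - h y) ∂P) (measure_lt_top _ _)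
        fun x hx => norm_setIntegral_le_of_norm_le_const (measure_lt_top _ _) (hc x hx)
      rw [hcell _ hA, hcell _ hB, Real.norm_eq_abs] at hI
      rw [hbeta k hk, abs_mul, abs_of_pos (by positivity), inv_mul_le_iff₀ (by positivity)]
      linarith
    have hL0 : 0 ≤ L := by
      obtain ⟨x, hx⟩ := hne _ hA
      obtain ⟨y, hy⟩ := hne _ hB
      have hxy : x ≠ y := (D.disjoint_of_ne (by omega) _ hA _ hB (by omega)).ne_of_mem hx hy
      exact nonneg_of_mul_nonneg_left ((abs_nonneg _).trans (hL x y))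
        (norm_pos_iff.2 (sub_ne_zero.2 hxy))
    refine le_min (hbound _ fun x _ y _ => ?_) (hbound _ fun x hx y hy => ?_)
    · linarith [abs_sub (h x) (h y), hM x, hM y]
    · refine (hL x y).trans (mul_le_mul_of_nonneg_left ?_ hL0)
      rw [norm_sub_rev]
      exact hs _ (hmem k hk x hx y hy)
end
end

section
/- Let P be a probability measure on ℝ^d with a dyadic expansion {C_{j,k}} of depth K, and let h = Σ_{q=1}^{Q} c_q·1_{C_{0,l_q}} be a linear combination of indicators of Q distinct terminal cells with |c_q| ≤ M̄ for all q. Then for every level 1 ≤ l ≤ K: Σ_{0≤m<2^{K−l}} β̃_{l,m}(h)² ≤ 4 · Q² · M̄² · 2^{−2l}. -/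
open MeasureTheory ProbabilityTheory Filter
open scoped ENNReal NNReal BigOperators Pointwise Classical

noncomputable section

lemma sum_range_two_mul_eq_sum_pairs (f : ℕ → ℝ) (n : ℕ) :
    ∑ k ∈ Finset.range (2 * n), f k = ∑ m ∈ Finset.range n, (f (2 * m) + f (2 * m + 1)) := by
  induction n with
  | zero => simp
  | succ n ih =>
    rw [show 2 * (n + 1) = 2 * n + 1 + 1 by ring, Finset.sum_range_succ, Finset.sum_range_succ,
      Finset.sum_range_succ, ih, add_assoc]

lemma sum_sq_le_sq_of_sum_abs_le {ι : Type*} (s : Finset ι) (a : ι → ℝ) {S : ℝ}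
    (hS : ∑ i ∈ s, |a i| ≤ S) : ∑ i ∈ s, a i ^ 2 ≤ S ^ 2 := by
  have h0 : 0 ≤ ∑ i ∈ s, |a i| := Finset.sum_nonneg fun i _ => abs_nonneg (a i)
  calc ∑ i ∈ s, a i ^ 2 = ∑ i ∈ s, |a i| * |a i| := by simp [sq]
    _ ≤ ∑ i ∈ s, |a i| * S := Finset.sum_le_sum fun i hi => by
        have := Finset.single_le_sum (fun i _ => abs_nonneg (a i)) hi
        exact mul_le_mul_of_nonneg_left (this.trans hS) (abs_nonneg _)
    _ = (∑ i ∈ s, |a i|) * S := by rw [Finset.sum_mul]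
    _ ≤ S ^ 2 := by rw [sq]; exact mul_le_mul_of_nonneg_right hS (h0.trans hS)

namespace QuasiDyadic

variable {d K : ℕ} {P : Measure (Euc d)} {ρ : ℝ}

lemma sum_setIntegral_eq (D : QuasiDyadic d P K ρ) {f : Euc d → ℝ} (hf : Integrable f P)
    (i : ℕ) (hi : i ≤ K) :
    ∑ k ∈ Finset.range (2 ^ i), ∫ x in D.C (K - i) k, f x ∂P = ∫ x in D.C K 0, f x ∂P := by
  induction i with
  | zero => simp
  | succ i ih =>
    rw [← ih (by omega), pow_succ', sum_range_two_mul_eq_sum_pairs]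
    refine Finset.sum_congr rfl fun m hm => ?_
    have hm' : m < 2 ^ (K - (K - i)) := by
      rw [show K - (K - i) = i by omega]
      exact Finset.mem_range.1 hm
    rw [D.union (K - i) m (by omega) (by omega) hm',
      setIntegral_union (D.disj (K - i) m (by omega) (by omega) hm') (D.meas _ _)
        hf.integrableOn hf.integrableOn, Nat.sub_sub]

lemma measureReal_cell [IsFiniteMeasure P] (D : QuasiDyadic d P K ρ)
    (hdy : ∀ k, k < 2 ^ K → P (D.C 0 k) = ((2 : ℝ≥0∞) ^ K)⁻¹) (j : ℕ) (hj : j ≤ K) (k : ℕ)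
    (hk : k < 2 ^ (K - j)) : P.real (D.C j k) = 2 ^ j / 2 ^ K := by
  induction j generalizing k with
  | zero => simp [measureReal_def, hdy k (by simpa using hk)]
  | succ j ih =>
    have hpow : 2 ^ (K - j) = 2 * 2 ^ (K - (j + 1)) := by
      rw [← pow_succ', show K - (j + 1) + 1 = K - j by omega]
    have hd := D.disj (j + 1) k (by omega) hj hk
    rw [D.union (j + 1) k (by omega) hj hk, measureReal_union hd (D.meas _ _)]
    simp only [Nat.add_sub_cancel]
    rw [ih (by omega) _ (by omega), ih (by omega) _ (by omega)]
    ring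

lemma sum_abs_betaC_le [IsFiniteMeasure P] (D : QuasiDyadic d P K ρ)
    (hdy : ∀ k, k < 2 ^ K → P (D.C 0 k) = ((2 : ℝ≥0∞) ^ K)⁻¹) {f : Euc d → ℝ}
    (hf : Integrable f P) {j : ℕ} (hj : j ≤ K) :
    ∑ k ∈ Finset.range (2 ^ (K - j)), |betaC P D.C j k f| ≤ (∫ x, |f x| ∂P) / (2 ^ j / 2 ^ K) := by
  have hsum := D.sum_setIntegral_eq hf.abs (K - j) (by omega)
  rw [show K - (K - j) = j by omega] at hsum
  calc ∑ k ∈ Finset.range (2 ^ (K - j)), |betaC P D.C j k f|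
      ≤ ∑ k ∈ Finset.range (2 ^ (K - j)), (∫ x in D.C j k, |f x| ∂P) / (2 ^ j / 2 ^ K) := by
        refine Finset.sum_le_sum fun k hk => ?_
        have hm := D.measureReal_cell hdy j hj k (Finset.mem_range.1 hk)
        rw [betaC, ← measureReal_def, hm, abs_div,
          abs_of_pos (by positivity : (0 : ℝ) < 2 ^ j / 2 ^ K)]
        gcongr
        exact abs_integral_le_integral_abs
    _ = (∫ x in D.C K 0, |f x| ∂P) / (2 ^ j / 2 ^ K) := by rw [← Finset.sum_div, hsum]
    _ ≤ (∫ x, |f x| ∂P) / (2 ^ j / 2 ^ K) := by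
        exact div_le_div_of_nonneg_right
          (setIntegral_le_integral hf.abs (Eventually.of_forall fun x => abs_nonneg _))
          (by positivity)

lemma sum_abs_betaT_le [IsFiniteMeasure P] (D : QuasiDyadic d P K ρ)
    (hdy : ∀ k, k < 2 ^ K → P (D.C 0 k) = ((2 : ℝ≥0∞) ^ K)⁻¹) {f : Euc d → ℝ}
    (hf : Integrable f P) {l : ℕ} (hl : 1 ≤ l) (hlK : l ≤ K) :
    ∑ m ∈ Finset.range (2 ^ (K - l)), |betaT P D.C l m f| ≤
      (∫ x, |f x| ∂P) / (2 ^ (l - 1) / 2 ^ K) := by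
  refine le_trans ?_ (D.sum_abs_betaC_le hdy hf (by omega))
  rw [show K - (l - 1) = K - l + 1 by omega, pow_succ', sum_range_two_mul_eq_sum_pairs]
  exact Finset.sum_le_sum fun m _ => abs_sub _ _

end QuasiDyadic

lemma integral_abs_sum_indicator_le {α ι : Type*} [MeasurableSpace α] [Fintype ι] (μ : Measure α)
    [IsFiniteMeasure μ] (A : ι → Set α) (hA : ∀ i, MeasurableSet (A i)) (c : ι → ℝ) :
    ∫ x, |∑ i, c i * (A i).indicator (fun _ => (1 : ℝ)) x| ∂μ ≤ ∑ i, |c i| * μ.real (A i) := by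
  have hint (i : ι) : Integrable ((A i).indicator (fun _ => (1 : ℝ))) μ :=
    (integrable_const 1).indicator (hA i)
  calc ∫ x, |∑ i, c i * (A i).indicator (fun _ => (1 : ℝ)) x| ∂μ
      ≤ ∫ x, ∑ i, |c i| * (A i).indicator (fun _ => (1 : ℝ)) x ∂μ := by
        refine integral_mono (integrable_finsetSum _ fun i _ => (hint i).const_mul _).abs
          (integrable_finsetSum _ fun i _ => (hint i).const_mul _) fun x => ?_
        refine (Finset.abs_sum_le_sum_abs _ _).trans (Finset.sum_le_sum fun i _ => ?_)
        rw [abs_mul, abs_of_nonneg (Set.indicator_nonneg (fun _ _ => zero_le_one) x)]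
    _ = ∑ i, |c i| * μ.real (A i) := by
        rw [integral_finsetSum _ fun i _ => (hint i).const_mul _]
        refine Finset.sum_congr rfl fun i _ => ?_
        rw [integral_const_mul, integral_indicator_const _ (hA i), smul_eq_mul, mul_one]

/-- For `h` a linear combination of indicators of `Q` distinct terminal cells
of a dyadic expansion, with coefficients bounded by `M̄`, the Haar coefficients at each level `l`
satisfy `∑_m β̃_{l,m}(h)² ≤ 4 Q² M̄² 2^{-2l}`. -/
theorem statement_17 (d K : ℕ) (P : Measure (Euc d)) (hP : IsProbabilityMeasure P)
    (D : QuasiDyadic d P K 1)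
    (hdy : ∀ k, k < 2 ^ K → P (D.C 0 k) = ((2 : ℝ≥0∞) ^ K)⁻¹)
    (Q : ℕ) (c : Fin Q → ℝ) (lq : Fin Q → ℕ) (Mbar : ℝ)
    (hinj : Function.Injective lq) (hlt : ∀ q, lq q < 2 ^ K)
    (hc : ∀ q, |c q| ≤ Mbar)
    (h : Euc d → ℝ)
    (hform : ∀ x, h x = ∑ q, c q * Set.indicator (D.C 0 (lq q)) (fun _ => (1 : ℝ)) x) :
    ∀ l : ℕ, 1 ≤ l → l ≤ K →
      (∑ m ∈ Finset.range (2 ^ (K - l)), betaT P D.C l m h ^ 2) ≤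
        4 * (Q : ℝ) ^ 2 * Mbar ^ 2 * ((2 : ℝ) ^ (2 * l))⁻¹ := by
  intro l hl hlK
  have hh : h = fun x => ∑ q, c q * Set.indicator (D.C 0 (lq q)) (fun _ => (1 : ℝ)) x :=
    funext hform
  have hint : Integrable h P := by
    rw [hh]
    exact integrable_finsetSum _ fun q _ =>
      ((integrable_const (1 : ℝ)).indicator (D.meas 0 (lq q))).const_mul _
  have hL1 : ∫ x, |h x| ∂P ≤ Q * Mbar / 2 ^ K := by
    rw [hh]
    refine (integral_abs_sum_indicator_le P _ (fun q => D.meas 0 (lq q)) c).trans ?_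
    calc ∑ q, |c q| * P.real (D.C 0 (lq q)) ≤ ∑ _q : Fin Q, Mbar * (1 / 2 ^ K) := by
          refine Finset.sum_le_sum fun q _ => ?_
          rw [D.measureReal_cell hdy 0 (Nat.zero_le K) (lq q) (hlt q), pow_zero]
          exact mul_le_mul_of_nonneg_right (hc q) (by positivity)
      _ = Q * Mbar / 2 ^ K := by simp [mul_assoc, div_eq_mul_inv]
  have hsum : ∑ m ∈ Finset.range (2 ^ (K - l)), |betaT P D.C l m h| ≤
      Q * Mbar / 2 ^ (l - 1) := by
    refine (D.sum_abs_betaT_le hdy hint hl hlK).trans ?_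
    calc (∫ x, |h x| ∂P) / (2 ^ (l - 1) / 2 ^ K)
        ≤ (Q * Mbar / 2 ^ K) / (2 ^ (l - 1) / 2 ^ K) := by gcongr
      _ = Q * Mbar / 2 ^ (l - 1) := by field_simp
  refine (sum_sq_le_sq_of_sum_abs_le _ _ hsum).trans_eq ?_
  obtain ⟨j, rfl⟩ : ∃ j, l = j + 1 := ⟨l - 1, by omega⟩
  rw [Nat.add_sub_cancel, pow_mul']
  field_simp
  ring
end
end

section
/- Let U ⊆ ℝ^d be open, let φ : U → V be a C¹ diffeomorphism onto an open set V ⊆ ℝ^d, and let h : U → ℝ be continuously differentiable with ∫_U ‖∇h(x)‖₂ dx < ∞. Assume c := sup_{x∈U} ( |det Dφ(x)| · ‖(Dφ(x))^{−1}‖_op ) < ∞, where ‖·‖_op is the operator norm with respect to Euclidean norms. Then ∫_V ‖∇(h∘φ^{−1})(u)‖₂ du ≤ c · ∫_U ‖∇h(x)‖₂ dx. -/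
open MeasureTheory ProbabilityTheory Filter
open scoped ENNReal NNReal BigOperators Pointwise Classical

noncomputable section

/-- The norm of the gradient is the norm of the Fréchet derivative. -/
theorem norm_gradient_eq_norm_fderiv {F : Type*} [NormedAddCommGroup F] [InnerProductSpace ℝ F]
    [CompleteSpace F] (f : F → ℝ) (x : F) : ‖gradient f x‖ = ‖fderiv ℝ f x‖ := by
  simp [gradient]

/-- A left inverse of a map which is `C¹` near `x` with invertible derivative at `x` has the
inverse derivative at the image point. -/
theorem hasFDerivAt_of_leftInvOn_of_continuousOn {E : Type*} [NormedAddCommGroup E]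
    [NormedSpace ℝ E] [CompleteSpace E] {U : Set E} {φ ψ : E → E} {Dφ : E → E →L[ℝ] E}
    (hU : IsOpen U) (hder : ∀ x ∈ U, HasFDerivAt φ (Dφ x) x) (hC1 : ContinuousOn Dφ U)
    (hψ : Set.LeftInvOn ψ φ U) {x : E} (hx : x ∈ U) {A : E →L[ℝ] E}
    (hleft : A.comp (Dφ x) = ContinuousLinearMap.id ℝ E)
    (hright : (Dφ x).comp A = ContinuousLinearMap.id ℝ E) :
    HasFDerivAt ψ A (φ x) := by
  have hUx : U ∈ nhds x := hU.mem_nhds hx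
  let e : E ≃L[ℝ] E := ContinuousLinearEquiv.equivOfInverse (Dφ x) A
    (fun v => DFunLike.congr_fun hleft v) (fun v => DFunLike.congr_fun hright v)
  have hstrict : HasStrictFDerivAt φ (e : E →L[ℝ] E) x :=
    hasStrictFDerivAt_of_hasFDerivAt_of_continuousAt
      (Filter.eventually_of_mem hUx hder) (hC1.continuousAt hUx)
  exact (hstrict.to_local_left_inverse (Filter.eventually_of_mem hUx hψ)).hasFDerivAt

/-- Change of variables for the total variation integral: if `φ : U → V` is a
`C¹` diffeomorphism with `sup_U |det Dφ| ‖(Dφ)⁻¹‖_op ≤ c` and `h` is `C¹` on `U` with integrable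
gradient, then `∫_V ‖∇(h ∘ φ⁻¹)‖₂ ≤ c ∫_U ‖∇h‖₂`. -/
theorem statement_19 (d : ℕ) (U V : Set (Euc d)) (φ ψ : Euc d → Euc d)
    (Dφ Dφinv : Euc d → Euc d →L[ℝ] Euc d) (h : Euc d → ℝ) (c : ℝ)
    (hU : IsOpen U) (hV : IsOpen V)
    (himg : φ '' U = V) (hinj : Set.InjOn φ U)
    (hder : ∀ x ∈ U, HasFDerivAt φ (Dφ x) x)
    (hC1 : ContinuousOn Dφ U)
    (hDinv : ∀ x ∈ U, (Dφinv x).comp (Dφ x) = ContinuousLinearMap.id ℝ (Euc d) ∧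
      (Dφ x).comp (Dφinv x) = ContinuousLinearMap.id ℝ (Euc d))
    (hψleft : ∀ x ∈ U, ψ (φ x) = x)
    (hψright : ∀ y ∈ V, ψ y ∈ U ∧ φ (ψ y) = y)
    (hhdiff : ∀ x ∈ U, DifferentiableAt ℝ h x)
    (hhC1 : ContinuousOn (fun x => gradient h x) U)
    (hhint : IntegrableOn (fun x => ‖gradient h x‖) U)
    (hc0 : 0 ≤ c)
    (hc : ∀ x ∈ U, |LinearMap.det (Dφ x : Euc d →ₗ[ℝ] Euc d)| * ‖Dφinv x‖ ≤ c) :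
    ∫ y in V, ‖gradient (h ∘ ψ) y‖ ≤ c * ∫ x in U, ‖gradient h x‖ := by
  have hbound : ∀ x ∈ U, ‖gradient (h ∘ ψ) (φ x)‖ ≤ ‖gradient h x‖ * ‖Dφinv x‖ := by
    intro x hx
    have hψ : HasFDerivAt ψ (Dφinv x) (φ x) :=
      hasFDerivAt_of_leftInvOn_of_continuousOn hU hder hC1 hψleft hx
        (hDinv x hx).1 (hDinv x hx).2
    have hh : HasFDerivAt h (fderiv ℝ h x) (ψ (φ x)) := by
      rw [hψleft x hx]
      exact (hhdiff x hx).hasFDerivAt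
    rw [norm_gradient_eq_norm_fderiv, norm_gradient_eq_norm_fderiv, (hh.comp (φ x) hψ).fderiv]
    exact ContinuousLinearMap.opNorm_comp_le _ _
  rw [← himg, integral_image_eq_integral_abs_det_fderiv_smul volume hU.measurableSet
    (fun x hx => (hder x hx).hasFDerivWithinAt) hinj, ← integral_const_mul]
  refine integral_mono_of_nonneg (Eventually.of_forall fun x => by positivity)
    (hhint.const_mul c) ?_
  filter_upwards [ae_restrict_mem hU.measurableSet] with x hx
  calc |(Dφ x).det| • ‖gradient (h ∘ ψ) (φ x)‖
      ≤ |(Dφ x).det| * (‖gradient h x‖ * ‖Dφinv x‖) :=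
        mul_le_mul_of_nonneg_left (hbound x hx) (abs_nonneg _)
    _ = |(Dφ x).det| * ‖Dφinv x‖ * ‖gradient h x‖ := by ring
    _ ≤ c * ‖gradient h x‖ := mul_le_mul_of_nonneg_right (hc x hx) (norm_nonneg _)
end
end
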